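/- arXiv:2009.12889 — 2 statements merged into one kernel-verified Lean document; each statement's English description precedes it below -/
import Mathlib

section
/- For every ordinal α with 1 ≤ α < ω₁ there exists a closed set F ⊆ 2^ω × ω^ω such that for every x ∈ 2^ω the section F_x is countable and relatively discrete (every point of F_x is isolated in the subspace F_x of ω^ω), and there is no sequence (B(n))_{n∈ℕ} of subsets of F with ⋃_{n∈ℕ} B(n) = F such that each B(n) belongs to the additive Borel class Σ⁰_α(2^ω × ω^ω) and for every n ∈ ℕ and every x ∈ 2^ω the section B(n)_x is a compact subset of ω^ω. -/
/-- The additive Borel class `Σ⁰_α(Z)` of a topological space `Z`. -/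
noncomputable def Sigma0 (Z : Type*) [TopologicalSpace Z] (α : Ordinal) : Set (Set Z) :=
  {s | (α = 1 ∧ IsOpen s) ∨
       (1 < α ∧ ∃ A : ℕ → Set Z, ∃ β : ℕ → Ordinal,
          (∀ n : ℕ, 1 ≤ β n ∧ ∃ hb : β n < α, A n ∈ Sigma0 Z (β n)) ∧ s = ⋃ n, (A n)ᶜ)}
termination_by α
decreasing_by exact hb

/-- The points of Baire space. -/
abbrev NSeq := ℕ → ℕ

section Sequences

variable {A : Type*}

/-- Prepend a term to a sequence. -/
def scons (a : A) (y : ℕ → A) : ℕ → A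
  | 0 => a
  | k + 1 => y k

/-- Drop the first term of a sequence. -/
def stail (y : ℕ → A) : ℕ → A := fun k => y (k + 1)

@[simp] lemma scons_zero (a : A) (y : ℕ → A) : scons a y 0 = a := rfl

@[simp] lemma stail_scons (a : A) (y : ℕ → A) : stail (scons a y) = y := rfl

@[simp] lemma scons_stail (y : ℕ → A) : scons (y 0) (stail y) = y := by
  funext k; cases k <;> rfl

lemma continuous_scons [TopologicalSpace A] :
    Continuous fun p : A × (ℕ → A) => scons p.1 p.2 := by
  refine continuous_pi fun k => ?_
  cases k with
  | zero => exact continuous_fst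
  | succ k => exact (continuous_apply k).comp continuous_snd

lemma continuous_stail [TopologicalSpace A] : Continuous (stail : (ℕ → A) → ℕ → A) :=
  continuous_pi fun k => continuous_apply (k + 1)

end Sequences

/-- Two sequences agree on their first `n` terms. -/
def Agree (n : ℕ) (x y : NSeq) : Prop := ∀ k < n, x k = y k

namespace Agree

variable {n m : ℕ} {x y w : NSeq}

lemma refl (n : ℕ) (x : NSeq) : Agree n x x := fun _ _ => rfl

lemma symm (h : Agree n x y) : Agree n y x := fun k hk => (h k hk).symm

lemma trans (h : Agree n x y) (h' : Agree n y w) : Agree n x w :=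
  fun k hk => (h k hk).trans (h' k hk)

lemma mono (h : Agree n x y) (hm : m ≤ n) : Agree m x y := fun k hk => h k (hk.trans_le hm)

lemma zero (x y : NSeq) : Agree 0 x y := fun k hk => absurd hk (Nat.not_lt_zero k)

lemma tail (h : Agree (n + 1) x y) : Agree n (stail x) (stail y) :=
  fun k hk => h (k + 1) (by omega)

lemma cons {a b : ℕ} (hab : a = b) (h : Agree n x y) :
    Agree (n + 1) (scons a x) (scons b y) := by
  intro k hk
  cases k with
  | zero => exact hab
  | succ k => exact h k (by omega)

end Agree

lemma eq_of_forall_agree {x y : NSeq} (h : ∀ n, Agree n x y) : x = y :=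
  funext fun k => h (k + 1) k k.lt_succ_self

lemma isOpen_agree (n : ℕ) (x : NSeq) : IsOpen {y : NSeq | Agree n x y} := by
  have : {y : NSeq | Agree n x y} = PiNat.cylinder x n := by
    ext y
    simp only [Set.mem_ofPred_eq, PiNat.mem_cylinder_iff, Agree]
    exact forall₂_congr fun _ _ => eq_comm
  rw [this]
  exact PiNat.isOpen_cylinder _ x n

lemma exists_agree_subset {U : Set NSeq} (hU : IsOpen U) {x : NSeq} (hx : x ∈ U) :
    ∃ n, ∀ y, Agree n x y → y ∈ U := by
  obtain ⟨_, ⟨w, n, rfl⟩, hxw, hw⟩ :=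
    (PiNat.isTopologicalBasis_cylinders fun _ : ℕ => ℕ).exists_subset_of_mem_open hx hU
  refine ⟨n, fun y hy => hw ?_⟩
  rw [PiNat.mem_cylinder_iff] at hxw ⊢
  exact fun k hk => (hy k hk).symm.trans (hxw k hk)

/-- Membership in each `D i` depends on the first `n` terms only. -/
def DetBy (n : ℕ) (D : ℕ → Set NSeq) : Prop :=
  ∀ i x y, Agree n x y → (x ∈ D i ↔ y ∈ D i)

lemma DetBy.compl {n : ℕ} {D : ℕ → Set NSeq} (h : DetBy n D) : DetBy n fun i => (D i)ᶜ :=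
  fun i x y hxy => not_congr (h i x y hxy)

/-- Binary relations on `ℕ × NSeq`, in curried form. -/
abbrev CtxRel := ℕ → NSeq → ℕ → NSeq → Prop

/-- The equivalence relation with the two classes `D` and its complement. -/
def sameSide (D : ℕ → Set NSeq) : CtxRel := fun i p i' p' => p ∈ D i ↔ p' ∈ D i'

/-- Unrelated points are separated by a finitely determined invariant set. -/
def Separated (E : CtxRel) : Prop :=
  ∀ i p i' p', ¬ E i p i' p' → ∃ n D, DetBy n D ∧
    (∀ j q j' q', E j q j' q' → sameSide D j q j' q') ∧ p ∈ D i ∧ p' ∉ D i'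

lemma Separated.refl {E : CtxRel} (h : Separated E) (i : ℕ) (p : NSeq) : E i p i p := by
  by_contra hn
  obtain ⟨_, _, _, _, h₁, h₂⟩ := h i p i p hn
  exact h₂ h₁

lemma separated_of_not_sameSide {E : CtxRel}
    (h : ∀ i p i' p', ¬ E i p i' p' → ∃ n D, DetBy n D ∧
      (∀ j q j' q', E j q j' q' → sameSide D j q j' q') ∧
        ¬ sameSide D i p i' p') : Separated E := by
  intro i p i' p' hn
  obtain ⟨n, D, hD, hinv, hs⟩ := h i p i' p' hn
  by_cases hp : p ∈ D i
  · exact ⟨n, D, hD, hinv, hp, fun hp' => hs (iff_of_true hp hp')⟩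
  · refine ⟨n, fun i => (D i)ᶜ, hD.compl, fun j q j' q' hE => not_congr (hinv j q j' q' hE), hp,
      fun hp' => hs (iff_of_false hp hp')⟩

lemma separated_sameSide {n : ℕ} {D : ℕ → Set NSeq} (hD : DetBy n D) : Separated (sameSide D) :=
  separated_of_not_sameSide fun _ _ _ _ hn => ⟨n, D, hD, fun _ _ _ _ h => h, hn⟩

lemma separated_true : Separated fun _ _ _ _ => True := fun _ _ _ _ h => absurd trivial h

/-- The image of a relation under a parametrised family of maps. -/
def Lift {Z : Type*} (K : Z → ℕ → NSeq → NSeq) (E : CtxRel) : CtxRel := fun i p i' p' =>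
  ∃ z y y', p = K z i y ∧ p' = K z i' y' ∧ E i y i' y'

/-- A family `K z i` of Lipschitz embeddings of Baire space, continuous in the parameter `z`,
which pushes separated relations to separated relations. -/
structure IsGadget {Z : Type*} [TopologicalSpace Z] (K : Z → ℕ → NSeq → NSeq) : Prop where
  cont : Continuous fun a : Z × ℕ × NSeq => K a.1 a.2.1 a.2.2
  lip : ∀ z i n y y', Agree n y y' → Agree n (K z i y) (K z i y')
  inj : ∀ z z' i y y', K z i y = K z' i y' → y = y' ∧ K z = K z'
  sep : ∀ E, Separated E → Separated (Lift K E)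
  expand : ∀ z i y n, ∃ N, ∀ y', Agree N (K z i y) (K z i y') → Agree n y y'

lemma IsGadget.surj {Z : Type*} [TopologicalSpace Z] {K : Z → ℕ → NSeq → NSeq} (hK : IsGadget K)
    (i : ℕ) (p : NSeq) : ∃ z y, p = K z i y := by
  obtain ⟨z, y, _, h, _⟩ := (hK.sep _ separated_true).refl i p
  exact ⟨z, y, h⟩

lemma IsGadget.cont_left {Z : Type*} [TopologicalSpace Z] {K : Z → ℕ → NSeq → NSeq}
    (hK : IsGadget K)
    (i : ℕ) (y : NSeq) : Continuous fun z => K z i y :=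
  hK.cont.comp (continuous_id.prodMk (continuous_const (y := (i, y))))

lemma IsGadget.comp_homeomorph {Z W : Type*} [TopologicalSpace Z] [TopologicalSpace W]
    {K : Z → ℕ → NSeq → NSeq} (hK : IsGadget K) (e : W ≃ₜ Z) : IsGadget fun w => K (e w) where
  cont := hK.cont.comp ((e.continuous.comp continuous_fst).prodMk continuous_snd)
  lip _ := hK.lip _
  inj _ _ := hK.inj _ _
  expand _ := hK.expand _
  sep E hE := by
    have : Lift (fun w => K (e w)) E = Lift K E := by
      funext i p i' p'
      refine propext ⟨fun ⟨w, h⟩ => ⟨e w, h⟩, fun ⟨z, h⟩ => ⟨e.symm z, ?_⟩⟩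
      simpa using h
    rw [this]
    exact hK.sep E hE

section InfiniteComposition

/-- The first `n` stages of the infinite composition of the families `G 0, G 1, …`. -/
def compApprox {Z : Type*} : ℕ → (ℕ → Z → ℕ → NSeq → NSeq) → (ℕ → Z) → ℕ → NSeq → NSeq
  | 0, _, _, _, y => y
  | n + 1, G, z, i, y =>
      G 0 (z 0) i (scons (y 0) (compApprox n (stail G) (stail z) (Nat.pair i (y 0)) (stail y)))

/-- The infinite composition of the families `G 0, G 1, …`. -/
def compInf {Z : Type*} (G : ℕ → Z → ℕ → NSeq → NSeq) (z : ℕ → Z) (i : ℕ) (y : NSeq) : NSeq :=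
  fun k => compApprox (k + 1) G z i y k

/-- The sequence to which the outermost family of an infinite composition is applied. -/
def compInner {Z : Type*} (G : ℕ → Z → ℕ → NSeq → NSeq) (z : ℕ → Z) (i : ℕ) (y : NSeq) : NSeq :=
  scons (y 0) (compInf (stail G) (stail z) (Nat.pair i (y 0)) (stail y))

variable {Z : Type*} [TopologicalSpace Z] {G : ℕ → Z → ℕ → NSeq → NSeq}

lemma compApprox_succ_agree (hG : ∀ n, IsGadget (G n)) (n : ℕ) (z : ℕ → Z) (i : ℕ) (y : NSeq) :
    Agree n (compApprox n G z i y) (compApprox (n + 1) G z i y) := by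
  induction n generalizing G z i y with
  | zero => exact Agree.zero _ _
  | succ n ih => exact (hG 0).lip _ _ _ _ _ (Agree.cons rfl (ih (fun n => hG (n + 1)) _ _ _))

lemma compApprox_agree (hG : ∀ n, IsGadget (G n)) {n m : ℕ} (hnm : n ≤ m) (z : ℕ → Z) (i : ℕ)
    (y : NSeq) : Agree n (compApprox n G z i y) (compApprox m G z i y) := by
  induction m, hnm using Nat.le_induction with
  | base => exact Agree.refl _ _
  | succ m hm ih => exact ih.trans ((compApprox_succ_agree hG m z i y).mono hm)

lemma compApprox_agree_compInf (hG : ∀ n, IsGadget (G n)) (n : ℕ) (z : ℕ → Z) (i : ℕ)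
    (y : NSeq) : Agree n (compApprox n G z i y) (compInf G z i y) := fun k hk =>
  (compApprox_agree hG (show k + 1 ≤ n from hk) z i y k k.lt_succ_self).symm

lemma compInf_eq (hG : ∀ n, IsGadget (G n)) (z : ℕ → Z) (i : ℕ) (y : NSeq) :
    compInf G z i y = G 0 (z 0) i (compInner G z i y) := by
  funext k
  exact (hG 0).lip _ _ (k + 1) _ _ (Agree.cons rfl
    (compApprox_agree_compInf (fun n => hG (n + 1)) k _ _ _)) k k.lt_succ_self

lemma compInf_agree (hG : ∀ n, IsGadget (G n)) (n : ℕ) (z : ℕ → Z) (i : ℕ) {y y' : NSeq}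
    (h : Agree n y y') : Agree n (compInf G z i y) (compInf G z i y') := by
  induction n generalizing G z i y y' with
  | zero => exact Agree.zero _ _
  | succ n ih =>
    rw [compInf_eq hG, compInf_eq hG]
    refine (hG 0).lip _ _ _ _ _ (Agree.cons (h 0 n.succ_pos) ?_)
    rw [h 0 n.succ_pos]
    exact ih (fun n => hG (n + 1)) _ _ h.tail

lemma compInf_congr (hG : ∀ n, IsGadget (G n)) {z z' : ℕ → Z} (h : ∀ n, G n (z n) = G n (z' n)) :
    compInf G z = compInf G z' := by
  funext i y
  refine eq_of_forall_agree fun n => ?_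
  induction n generalizing G z z' i y with
  | zero => exact Agree.zero _ _
  | succ n ih =>
    rw [compInf_eq hG, compInf_eq hG, h 0]
    exact (hG 0).lip _ _ _ _ _ (Agree.cons rfl (ih (fun n => hG (n + 1)) (fun n => h (n + 1)) _ _))

lemma compInf_inj_apply (hG : ∀ n, IsGadget (G n)) (n : ℕ) {z z' : ℕ → Z} {i : ℕ} {y y' : NSeq}
    (h : compInf G z i y = compInf G z' i y') : G n (z n) = G n (z' n) ∧ y n = y' n := by
  induction n generalizing G z z' i y y' with
  | zero =>
    rw [compInf_eq hG, compInf_eq hG] at h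
    obtain ⟨h₁, h₂⟩ := (hG 0).inj _ _ _ _ _ h
    exact ⟨h₂, congrFun h₁ 0⟩
  | succ n ih =>
    rw [compInf_eq hG, compInf_eq hG] at h
    obtain ⟨h₁, h₂⟩ := (hG 0).inj _ _ _ _ _ h
    have h0 : y 0 = y' 0 := congrFun h₁ 0
    have ht := congrArg stail h₁
    simp only [compInner, stail_scons, h0] at ht
    exact ih (fun n => hG (n + 1)) ht

lemma compInf_expand (hG : ∀ n, IsGadget (G n)) (n : ℕ) (z : ℕ → Z) (i : ℕ) (y : NSeq) :
    ∃ N, ∀ y', Agree N (compInf G z i y) (compInf G z i y') → Agree n y y' := by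
  induction n generalizing G z i y with
  | zero => exact ⟨0, fun _ _ => Agree.zero _ _⟩
  | succ n ih =>
    obtain ⟨M, hM⟩ := ih (fun n => hG (n + 1)) (stail z) (Nat.pair i (y 0)) (stail y)
    obtain ⟨N, hN⟩ := (hG 0).expand (z 0) i (compInner G z i y) (M + 1)
    refine ⟨N, fun y' h => ?_⟩
    rw [compInf_eq hG, compInf_eq hG] at h
    have h' := hN _ h
    have h0 : y 0 = y' 0 := h' 0 M.succ_pos
    have ht := h'.tail
    simp only [compInner, stail_scons, ← h0] at ht
    have := (hM _ ht).cons h0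
    simpa using this

lemma compApprox_continuous (hG : ∀ n, IsGadget (G n)) (n : ℕ) :
    Continuous fun a : (ℕ → Z) × ℕ × NSeq => compApprox n G a.1 a.2.1 a.2.2 := by
  induction n generalizing G with
  | zero => exact continuous_snd.comp continuous_snd
  | succ n ih =>
    have hy : Continuous fun a : (ℕ → Z) × ℕ × NSeq => a.2.2 := continuous_snd.comp continuous_snd
    have hi : Continuous fun a : (ℕ → Z) × ℕ × NSeq => a.2.1 := continuous_fst.comp continuous_snd
    have hp : Continuous fun a : (ℕ → Z) × ℕ × NSeq => Nat.pair a.2.1 (a.2.2 0) :=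
      (continuous_of_discreteTopology (f := fun p : ℕ × ℕ => Nat.pair p.1 p.2)).comp
        (hi.prodMk ((continuous_apply 0).comp hy))
    have h := (ih fun n => hG (n + 1)).comp
      ((continuous_stail.comp continuous_fst).prodMk (hp.prodMk (continuous_stail.comp hy)))
    exact (hG 0).cont.comp (((continuous_apply 0).comp continuous_fst).prodMk
      (hi.prodMk (continuous_scons.comp (((continuous_apply 0).comp hy).prodMk h))))

lemma compInf_continuous (hG : ∀ n, IsGadget (G n)) :
    Continuous fun a : (ℕ → Z) × ℕ × NSeq => compInf G a.1 a.2.1 a.2.2 :=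
  continuous_pi fun k => (continuous_apply k).comp (compApprox_continuous hG (k + 1))

lemma compInf_surj (hG : ∀ n, IsGadget (G n)) (i : ℕ) (p : NSeq) :
    ∃ z y, p = compInf G z i y := by
  choose zf qf hf using fun n => (hG n).surj
  let st : ℕ → ℕ × NSeq := fun n => Nat.rec (i, p) (fun n s =>
    (Nat.pair s.1 (qf n s.1 s.2 0), stail (qf n s.1 s.2))) n
  let z : ℕ → Z := fun n => zf n (st n).1 (st n).2
  let y : NSeq := fun n => qf n (st n).1 (st n).2 0
  have key : ∀ n m, Agree n (st m).2
      (compInf (fun k => G (k + m)) (fun k => z (k + m)) (st m).1 (fun k => y (k + m))) := by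
    intro n
    induction n with
    | zero => exact fun _ => Agree.zero _ _
    | succ n ih =>
      intro m
      have e : (st m).2 = G (0 + m) (z (0 + m)) (st m).1 (scons (y (0 + m)) (st (m + 1)).2) := by
        simp only [zero_add]
        conv_lhs => rw [hf m (st m).1 (st m).2]
        exact congrArg _ (scons_stail _).symm
      rw [e, compInf_eq fun k => hG (k + m)]
      refine (hG (0 + m)).lip _ _ _ _ _ (Agree.cons rfl ?_)
      have := ih (m + 1)
      have hG' : stail (fun k => G (k + m)) = fun k => G (k + (m + 1)) :=
        funext fun k => congrArg G (by omega)
      have hz' : stail (fun k => z (k + m)) = fun k => z (k + (m + 1)) :=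
        funext fun k => congrArg z (by omega)
      have hy' : stail (fun k => y (k + m)) = fun k => y (k + (m + 1)) :=
        funext fun k => congrArg y (by omega)
      rw [hG', hz', hy']
      simpa [st, y] using this
  exact ⟨z, y, eq_of_forall_agree fun n => key n 0⟩

lemma exists_separating_compInner {z z' : ℕ → Z} {i i' : ℕ} {y y' : NSeq} {m : ℕ}
    {D : ℕ → Set NSeq} (hG : ∀ n, IsGadget (G n)) (hD : DetBy m D)
    (h : compInf (stail G) (stail z) (Nat.pair i (y 0)) (stail y) ∈ D (Nat.pair i (y 0)))
    (h' : compInf (stail G) (stail z') (Nat.pair i' (y' 0)) (stail y') ∉ D (Nat.pair i' (y' 0)))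
    (E : CtxRel) (hE : ∀ w j a j' b, E j a j' b →
      (compInf (stail G) w (Nat.pair j (a 0)) (stail a) ∈ D (Nat.pair j (a 0)) ↔
        compInf (stail G) w (Nat.pair j' (b 0)) (stail b) ∈ D (Nat.pair j' (b 0)))) :
    ∃ n D', DetBy n D' ∧ (∀ j q j' q', Lift (compInf G) E j q j' q' → sameSide D' j q j' q') ∧
      compInf G z i y ∈ D' i ∧ compInf G z' i' y' ∉ D' i' := by
  let C : ℕ → Set NSeq := fun j => {q | stail q ∈ D (Nat.pair j (q 0))}
  have hC : DetBy (m + 1) C := by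
    intro j p q hpq
    have h0 : p 0 = q 0 := hpq 0 m.succ_pos
    change stail p ∈ D _ ↔ stail q ∈ D _
    rw [h0]
    exact hD _ _ _ hpq.tail
  obtain ⟨n, D', hD', hinv, h₁, h₂⟩ := (hG 0).sep _ (separated_sameSide hC) i
    (compInf G z i y) i' (compInf G z' i' y') (by
      rintro ⟨w, a, b, ha, hb, hab⟩
      rw [compInf_eq hG] at ha hb
      rw [← ((hG 0).inj _ _ _ _ _ ha).1, ← ((hG 0).inj _ _ _ _ _ hb).1] at hab
      exact h' (hab.1 h))
  refine ⟨n, D', hD', ?_, h₁, h₂⟩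
  rintro j _ j' _ ⟨w, a, b, rfl, rfl, hab⟩
  refine hinv _ _ _ _ ⟨w 0, _, _, compInf_eq hG _ _ _, compInf_eq hG _ _ _, ?_⟩
  exact hE (stail w) _ _ _ _ hab

lemma exists_separating_of_param_ne (hG : ∀ n, IsGadget (G n)) (n : ℕ) {z z' : ℕ → Z}
    (hn : G n (z n) ≠ G n (z' n)) (i : ℕ) (y : NSeq) (i' : ℕ) (y' : NSeq) :
    ∃ n D, DetBy n D ∧
      (∀ j q j' q', Lift (compInf G) (fun _ _ _ _ => True) j q j' q' → sameSide D j q j' q') ∧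
      compInf G z i y ∈ D i ∧ compInf G z' i' y' ∉ D i' := by
  induction n generalizing G z z' i y i' y' with
  | zero =>
    obtain ⟨n, D, hD, hinv, h₁, h₂⟩ := (hG 0).sep _ separated_true i
      (compInf G z i y) i' (compInf G z' i' y') (by
        rintro ⟨w, a, b, ha, hb, -⟩
        rw [compInf_eq hG] at ha hb
        exact hn (((hG 0).inj _ _ _ _ _ ha).2.trans ((hG 0).inj _ _ _ _ _ hb).2.symm))
    refine ⟨n, D, hD, ?_, h₁, h₂⟩
    rintro j _ j' _ ⟨w, a, b, rfl, rfl, -⟩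
    exact hinv _ _ _ _ ⟨w 0, _, _, compInf_eq hG _ _ _, compInf_eq hG _ _ _, trivial⟩
  | succ n ih =>
    obtain ⟨m, D, hD, hinv, h₁, h₂⟩ := ih (fun n => hG (n + 1)) (z := stail z) (z' := stail z') hn
      (Nat.pair i (y 0)) (stail y) (Nat.pair i' (y' 0)) (stail y')
    exact exists_separating_compInner hG hD h₁ h₂ _ fun w j a j' b _ =>
      hinv _ _ _ _ ⟨w, _, _, rfl, rfl, trivial⟩

lemma exists_separating_of_sameSide (hG : ∀ n, IsGadget (G n)) {n : ℕ} {C : ℕ → Set NSeq}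
    (hC : DetBy n C) (z z' : ℕ → Z) {i : ℕ} {y : NSeq} {i' : ℕ} {y' : NSeq} (h : y ∈ C i)
    (h' : y' ∉ C i') :
    ∃ n D, DetBy n D ∧ (∀ j q j' q', Lift (compInf G) (sameSide C) j q j' q' →
      sameSide D j q j' q') ∧ compInf G z i y ∈ D i ∧ compInf G z' i' y' ∉ D i' := by
  induction n generalizing G C z z' i y i' y' with
  | zero =>
    have hC' : ∀ i x y, x ∈ C i ↔ y ∈ C i := fun i x y => hC i x y (Agree.zero _ _)
    refine ⟨0, C, hC, ?_, (hC' _ _ _).1 h, fun h₂ => h' ((hC' _ _ _).1 h₂)⟩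
    rintro j _ j' _ ⟨w, a, b, rfl, rfl, hab⟩
    exact ((hC' _ _ _).trans hab).trans (hC' _ _ _)
  | succ n ih =>
    let C' : ℕ → Set NSeq := fun c => {q | scons c.unpair.2 q ∈ C c.unpair.1}
    have hC' : DetBy n C' := fun c p q hpq => hC _ _ _ (Agree.cons rfl hpq)
    have mem : ∀ j a, stail a ∈ C' (Nat.pair j (a 0)) ↔ a ∈ C j := fun j a => by
      simp [C']
    obtain ⟨m, D, hD, hinv, h₁, h₂⟩ := ih (fun n => hG (n + 1)) hC' (stail z) (stail z')
      ((mem i y).2 h) (fun hy => h' ((mem i' y').1 hy))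
    refine exists_separating_compInner hG hD h₁ h₂ _ fun w j a j' b hab => ?_
    exact hinv _ _ _ _ ⟨w, _, _, rfl, rfl, ((mem _ _).trans hab).trans (mem _ _).symm⟩

lemma IsGadget.compInf (hG : ∀ n, IsGadget (G n)) : IsGadget (compInf G) where
  cont := compInf_continuous hG
  lip z i n _ _ h := compInf_agree hG n z i h
  inj _ _ _ _ _ h := ⟨funext fun n => (compInf_inj_apply hG n h).2,
    compInf_congr hG fun n => (compInf_inj_apply hG n h).1⟩
  expand z i y n := compInf_expand hG n z i y
  sep E hE i p i' p' hn := by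
    obtain ⟨z, y, rfl⟩ := compInf_surj hG i p
    obtain ⟨z', y', rfl⟩ := compInf_surj hG i' p'
    by_cases hz : ∀ n, G n (z n) = G n (z' n)
    · have hE' : ¬ E i y i' y' := fun h => hn ⟨z, y, y', rfl, by rw [compInf_congr hG hz], h⟩
      obtain ⟨n, C, hC, hinv, h₁, h₂⟩ := hE _ _ _ _ hE'
      obtain ⟨m, D, hD, hinv', h₃, h₄⟩ := exists_separating_of_sameSide hG hC z z' h₁ h₂
      refine ⟨m, D, hD, ?_, h₃, h₄⟩
      rintro j q j' q' ⟨w, a, b, ha, hb, hab⟩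
      exact hinv' _ _ _ _ ⟨w, a, b, ha, hb, hinv _ _ _ _ hab⟩
    · push Not at hz
      obtain ⟨n, hn⟩ := hz
      obtain ⟨m, D, hD, hinv, h₁, h₂⟩ := exists_separating_of_param_ne hG n hn i y i' y'
      refine ⟨m, D, hD, ?_, h₁, h₂⟩
      rintro j q j' q' ⟨w, a, b, ha, hb, -⟩
      exact hinv _ _ _ _ ⟨w, a, b, ha, hb, trivial⟩

end InfiniteComposition

section BasicGadget

/-- Write the list `t` shifted by one, then the marker `0`, then the sequence `y`. -/
def insertZero : List ℕ → NSeq → NSeq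
  | [], y => scons 0 y
  | a :: t, y => scons (a + 1) (insertZero t y)

lemma insertZero_agree (t : List ℕ) {n : ℕ} {y y' : NSeq} (h : Agree n y y') :
    Agree n (insertZero t y) (insertZero t y') := by
  induction t with
  | nil => exact (Agree.cons rfl h).mono n.le_succ
  | cons a t ih => exact (Agree.cons rfl ih).mono n.le_succ

lemma insertZero_inj {t t' : List ℕ} {y y' : NSeq} (h : insertZero t y = insertZero t' y') :
    t = t' ∧ y = y' := by
  induction t generalizing t' with
  | nil =>
    cases t' with
    | nil => exact ⟨rfl, congrArg stail h⟩
    | cons b t' => exact absurd (congrFun h 0) (Nat.succ_ne_zero b).symm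
  | cons a t ih =>
    cases t' with
    | nil => exact absurd (congrFun h 0) (Nat.succ_ne_zero a)
    | cons b t' =>
      obtain ⟨rfl, h₂⟩ := ih (congrArg stail h)
      exact ⟨by rw [Nat.succ.inj (congrFun h 0)], h₂⟩

lemma exists_insertZero_of_agree (t : List ℕ) {n : ℕ} {y q : NSeq}
    (h : Agree (n + t.length + 1) (insertZero t y) q) :
    ∃ y', q = insertZero t y' ∧ Agree n y y' := by
  induction t generalizing q with
  | nil =>
    refine ⟨stail q, ?_, h.tail⟩
    conv_lhs => rw [← scons_stail q, ← h 0 (by omega)]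
    rfl
  | cons a t ih =>
    obtain ⟨y', h₁, h₂⟩ := ih h.tail
    refine ⟨y', ?_, h₂⟩
    conv_lhs => rw [← scons_stail q, ← h 0 (by omega), h₁]
    rfl

lemma exists_eq_insertZero {q : NSeq} {k : ℕ} (hk : q k = 0) : ∃ t y, q = insertZero t y := by
  induction k generalizing q with
  | zero => exact ⟨[], stail q, by rw [insertZero, ← hk, scons_stail]⟩
  | succ k ih =>
    by_cases h0 : q 0 = 0
    · exact ⟨[], stail q, by rw [insertZero, ← h0, scons_stail]⟩
    · obtain ⟨t, y, h⟩ := ih (q := stail q) hk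
      refine ⟨(q 0 - 1) :: t, y, ?_⟩
      conv_lhs => rw [← scons_stail q, h, ← Nat.sub_add_cancel (Nat.one_le_iff_ne_zero.2 h0)]
      rfl

lemma insertZero_ne_succ (t : List ℕ) (y x : NSeq) : insertZero t y ≠ fun k => x k + 1 := by
  intro h
  induction t generalizing x with
  | nil => exact (Nat.succ_ne_zero _ (congrFun h 0).symm)
  | cons a t ih => exact ih (stail x) (congrArg stail h)

lemma exists_insertZero_agree (N : ℕ) (x : NSeq) :
    ∃ t, ∀ y, Agree N (fun k => x k + 1) (insertZero t y) := by
  induction N generalizing x with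
  | zero => exact ⟨[], fun _ => Agree.zero _ _⟩
  | succ N ih =>
    obtain ⟨t, ht⟩ := ih (stail x)
    refine ⟨x 0 :: t, fun y => ?_⟩
    rw [← scons_stail fun k => x k + 1]
    exact Agree.cons rfl (ht y)

/-- The sequence `x` is compatible with the part of `r` before its first zero, decoded by
subtracting one, as far as the first `n` terms are concerned. -/
def Matches : ℕ → NSeq → NSeq → Prop
  | 0, _, _ => True
  | n + 1, r, x => r 0 ≠ 0 → x 0 + 1 = r 0 ∧ Matches n (stail r) (stail x)

lemma matches_congr {n : ℕ} {r r' : NSeq} (h : Agree n r r') (x : NSeq) :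
    Matches n r x ↔ Matches n r' x := by
  induction n generalizing r r' x with
  | zero => exact Iff.rfl
  | succ n ih => rw [Matches, Matches, h 0 n.succ_pos, ih h.tail]

lemma matches_insertZero (n : ℕ) (t : List ℕ) (y y' x : NSeq) :
    Matches n (insertZero t y) x ↔ Matches n (insertZero t y') x := by
  induction n generalizing t x with
  | zero => exact Iff.rfl
  | succ n ih =>
    cases t with
    | nil => exact iff_of_true (fun h => absurd rfl h) (fun h => absurd rfl h)
    | cons a t => exact imp_congr Iff.rfl (and_congr Iff.rfl (ih t (stail x)))

lemma matches_succ_iff (n : ℕ) (y x : NSeq) :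
    Matches n (fun k => y k + 1) x ↔ Agree n y x := by
  induction n generalizing y x with
  | zero => exact iff_of_true trivial (Agree.zero _ _)
  | succ n ih =>
    constructor
    · intro h
      obtain ⟨h₁, h₂⟩ := h (Nat.succ_ne_zero _)
      have := Agree.cons (Nat.succ.inj h₁).symm ((ih (stail y) (stail x)).1 h₂)
      simpa using this
    · exact fun h _ => ⟨congrArg Nat.succ (h 0 n.succ_pos).symm,
        (ih (stail y) (stail x)).2 h.tail⟩

/-- The order preserving bijection from `ℕ` to `ℕ \ {i}`. -/
def skipAt (i s : ℕ) : ℕ := if s < i then s else s + 1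

/-- The inverse of `skipAt i`. -/
def unskipAt (i s : ℕ) : ℕ := if s < i then s else s - 1

lemma skipAt_ne (i s : ℕ) : skipAt i s ≠ i := by
  unfold skipAt; split_ifs <;> omega

lemma unskipAt_skipAt (i s : ℕ) : unskipAt i (skipAt i s) = s := by
  unfold unskipAt skipAt; split_ifs <;> omega

lemma skipAt_unskipAt {i s : ℕ} (h : s ≠ i) : skipAt i (unskipAt i s) = s := by
  unfold unskipAt skipAt; split_ifs <;> omega

/-- The basic family of embeddings, with a discrete parameter. -/
def basicMap : Option (ℕ × List ℕ) → ℕ → NSeq → NSeq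
  | none, _, y => scons 0 fun k => y k + 1
  | some e, i, y =>
      if e.1 = i then scons 0 (insertZero e.2 y)
      else scons (Encodable.encode (unskipAt i e.1, e.2) + 1) y

lemma basicMap_self (s : ℕ) (t : List ℕ) (y : NSeq) :
    basicMap (some (s, t)) s y = scons 0 (insertZero t y) := if_pos rfl

lemma basicMap_ne {s i : ℕ} (h : s ≠ i) (t : List ℕ) (y : NSeq) :
    basicMap (some (s, t)) i y = scons (Encodable.encode (unskipAt i s, t) + 1) y := if_neg h

lemma basicMap_agree (c : Option (ℕ × List ℕ)) (i : ℕ) {n : ℕ} {y y' : NSeq}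
    (h : Agree n y y') : Agree n (basicMap c i y) (basicMap c i y') := by
  rcases c with _ | ⟨s, t⟩
  · exact (Agree.cons rfl fun k hk => congrArg Nat.succ (h k hk)).mono n.le_succ
  · by_cases hs : s = i
    · subst hs
      rw [basicMap_self, basicMap_self]
      exact (Agree.cons rfl (insertZero_agree t h)).mono n.le_succ
    · rw [basicMap_ne hs, basicMap_ne hs]
      exact (Agree.cons rfl h).mono n.le_succ

lemma basicMap_inj {c c' : Option (ℕ × List ℕ)} {i : ℕ} {y y' : NSeq}
    (h : basicMap c i y = basicMap c' i y') : c = c' ∧ y = y' := by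
  have h0 := congrFun h 0
  have ht := congrArg stail h
  rcases c with _ | ⟨s, t⟩ <;> rcases c' with _ | ⟨s', t'⟩
  · exact ⟨rfl, funext fun k => Nat.succ.inj (congrFun ht k)⟩
  · by_cases hs : s' = i
    · subst hs
      rw [basicMap_self] at ht
      exact absurd ht.symm (insertZero_ne_succ _ _ _)
    · rw [basicMap_ne hs] at h0
      exact absurd h0.symm (Nat.succ_ne_zero _)
  · by_cases hs : s = i
    · subst hs
      rw [basicMap_self] at ht
      exact absurd ht (insertZero_ne_succ _ _ _)
    · rw [basicMap_ne hs] at h0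
      exact absurd h0 (Nat.succ_ne_zero _)
  · by_cases hs : s = i <;> by_cases hs' : s' = i
    · subst hs hs'
      rw [basicMap_self, basicMap_self] at ht
      obtain ⟨rfl, h₂⟩ := insertZero_inj ht
      exact ⟨rfl, h₂⟩
    · subst hs
      rw [basicMap_self, basicMap_ne hs'] at h0
      exact absurd h0.symm (Nat.succ_ne_zero _)
    · subst hs'
      rw [basicMap_self, basicMap_ne hs] at h0
      exact absurd h0 (Nat.succ_ne_zero _)
    · rw [basicMap_ne hs, basicMap_ne hs'] at h0 ht
      have := Prod.ext_iff.1 (Encodable.encode_injective (Nat.succ.inj h0))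
      refine ⟨?_, ht⟩
      rw [← skipAt_unskipAt hs, ← skipAt_unskipAt hs']
      simp only at this
      rw [this.1, this.2]

lemma basicMap_surj (i : ℕ) (p : NSeq) : ∃ c y, p = basicMap c i y := by
  by_cases h0 : p 0 = 0
  · by_cases hk : ∃ k, stail p k = 0
    · obtain ⟨k, hk⟩ := hk
      obtain ⟨t, y, h⟩ := exists_eq_insertZero hk
      refine ⟨some (i, t), y, ?_⟩
      rw [basicMap_self, ← h, ← h0, scons_stail]
    · push Not at hk
      refine ⟨none, fun k => stail p k - 1, ?_⟩
      conv_lhs => rw [← scons_stail p, h0]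
      exact congrArg _ (funext fun k => (Nat.sub_add_cancel (Nat.one_le_iff_ne_zero.2 (hk k))).symm)
  · obtain ⟨⟨u, t⟩, he⟩ : ∃ e : ℕ × List ℕ, Encodable.encode e = p 0 - 1 :=
      ⟨Denumerable.ofNat _ (p 0 - 1), Denumerable.encode_ofNat _⟩
    refine ⟨some (skipAt i u, t), stail p, ?_⟩
    rw [basicMap_ne (skipAt_ne i u), unskipAt_skipAt, he,
      Nat.sub_add_cancel (Nat.one_le_iff_ne_zero.2 h0), scons_stail]

lemma exists_basicMap_some_of_agree (e : ℕ × List ℕ) (i : ℕ) {n : ℕ} {y q : NSeq}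
    (h : Agree (n + e.2.length + 2) (basicMap (some e) i y) q) :
    ∃ y', q = basicMap (some e) i y' ∧ Agree n y y' := by
  obtain ⟨s, t⟩ := e
  by_cases hs : s = i
  · subst hs
    rw [basicMap_self] at h
    obtain ⟨y', h₁, h₂⟩ := exists_insertZero_of_agree t (n := n) (y := y) (q := stail q) h.tail
    refine ⟨y', ?_, h₂⟩
    rw [basicMap_self, ← h₁, ← scons_zero 0 (insertZero t y), h 0 (by omega), scons_stail]
  · rw [basicMap_ne hs] at h
    refine ⟨stail q, ?_, h.tail.mono (by omega)⟩
    rw [basicMap_ne hs]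
    conv_lhs => rw [← scons_stail q, ← h 0 (by omega)]
    rfl

lemma basicMap_expand (c : Option (ℕ × List ℕ)) (i : ℕ) (y : NSeq) (n : ℕ) :
    ∃ N, ∀ y', Agree N (basicMap c i y) (basicMap c i y') → Agree n y y' := by
  rcases c with _ | e
  · exact ⟨n + 1, fun y' h k hk => Nat.succ.inj (h (k + 1) (by omega))⟩
  · refine ⟨n + e.2.length + 2, fun y' h => ?_⟩
    obtain ⟨x, h₁, h₂⟩ := exists_basicMap_some_of_agree e i h
    rwa [(basicMap_inj h₁).2]

lemma exists_detBy_basicMap_some (e : ℕ × List ℕ) {n : ℕ} {D : ℕ → Set NSeq} (hD : DetBy n D) :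
    ∃ m D', DetBy m D' ∧ ∀ c i y, basicMap c i y ∈ D' i ↔ c = some e ∧ y ∈ D i := by
  have key : ∀ i x y, Agree (n + e.2.length + 2) x y →
      x ∈ basicMap (some e) i '' D i → y ∈ basicMap (some e) i '' D i := by
    rintro i _ y hxy ⟨x, hx, rfl⟩
    obtain ⟨y', h₁, h₂⟩ := exists_basicMap_some_of_agree e i hxy
    exact ⟨y', (hD _ _ _ h₂).1 hx, h₁.symm⟩
  refine ⟨_, fun i => basicMap (some e) i '' D i,
    fun i x y h => ⟨key i x y h, key i y x h.symm⟩, fun c i y => ⟨?_, ?_⟩⟩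
  · rintro ⟨x, hx, h⟩
    obtain ⟨rfl, rfl⟩ := basicMap_inj h
    exact ⟨rfl, hx⟩
  · rintro ⟨rfl, hy⟩
    exact ⟨y, hy, rfl⟩

lemma exists_detBy_basicMap_none {n : ℕ} {D : ℕ → Set NSeq} (hD : DetBy n D) :
    ∃ m D', DetBy m D' ∧ (∀ i y, basicMap none i y ∈ D' i ↔ y ∈ D i) ∧
      ∀ e i y i' y', basicMap (some e) i y ∈ D' i ↔ basicMap (some e) i' y' ∈ D' i' := by
  let Q : ℕ → NSeq → Prop := fun i r => ∀ x, Matches n r x → x ∈ D i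
  let d : ℕ → ℕ × List ℕ := Denumerable.ofNat (ℕ × List ℕ)
  let D' : ℕ → Set NSeq := fun i => {q | (q 0 = 0 → Q i (stail q)) ∧
    (q 0 ≠ 0 → Q (skipAt i (d (q 0 - 1)).1) (insertZero (d (q 0 - 1)).2 0))}
  have some_mem : ∀ e i y, basicMap (some e) i y ∈ D' i ↔ Q e.1 (insertZero e.2 0) := by
    rintro ⟨s, t⟩ i y
    by_cases hs : s = i
    · subst hs
      rw [basicMap_self]
      exact ⟨fun h x hx => h.1 rfl x ((matches_insertZero n t y 0 x).2 hx),
        fun h => ⟨fun _ x hx => h x ((matches_insertZero n t y 0 x).1 hx), fun h' => absurd rfl h'⟩⟩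
    · rw [basicMap_ne hs]
      have hd : d (Encodable.encode (unskipAt i s, t) + 1 - 1) = (unskipAt i s, t) :=
        Denumerable.ofNat_encode _
      change (_ → _) ∧ (_ → Q (skipAt i (d (Encodable.encode (unskipAt i s, t) + 1 - 1)).1)
        (insertZero (d (Encodable.encode (unskipAt i s, t) + 1 - 1)).2 0)) ↔ _
      rw [hd, skipAt_unskipAt hs]
      exact ⟨fun h => h.2 (Nat.succ_ne_zero _), fun h => ⟨fun h' => absurd h' (Nat.succ_ne_zero _),
        fun _ => h⟩⟩
  refine ⟨n + 1, D', ?_, ?_, fun e i y i' y' => (some_mem e i y).trans (some_mem e i' y').symm⟩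
  · intro i x y h
    have h0 : x 0 = y 0 := h 0 n.succ_pos
    have hQ : Q i (stail x) ↔ Q i (stail y) :=
      forall_congr' fun w => imp_congr (matches_congr h.tail w) Iff.rfl
    change (_ → _) ∧ (_ → _) ↔ (_ → _) ∧ (_ → _)
    rw [h0, hQ]
  · intro i y
    have : basicMap none i y ∈ D' i ↔ Q i fun k => y k + 1 :=
      ⟨fun h => h.1 rfl, fun h => ⟨fun _ => h, fun h' => absurd rfl h'⟩⟩
    rw [this]
    exact ⟨fun h => h y ((matches_succ_iff n y y).2 (Agree.refl _ _)),
      fun h x hx => (hD i y x ((matches_succ_iff n y x).1 hx)).1 h⟩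

lemma separated_lift_basicMap {E : CtxRel} (hE : Separated E) : Separated (Lift basicMap E) := by
  have ne_case : ∀ (e : ℕ × List ℕ) c i y i' y', c ≠ some e → ∃ n D, DetBy n D ∧
      (∀ j q j' q', Lift basicMap E j q j' q' → sameSide D j q j' q') ∧
      ¬ sameSide D i (basicMap (some e) i y) i' (basicMap c i' y') ∧
      ¬ sameSide D i' (basicMap c i' y') i (basicMap (some e) i y) := by
    intro e c i y i' y' hc
    obtain ⟨m, D, hD, h⟩ := exists_detBy_basicMap_some e (n := 0) (D := fun _ => Set.univ)
      (fun _ _ _ _ => Iff.rfl)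
    have h₁ : basicMap (some e) i y ∈ D i := (h _ _ _).2 ⟨rfl, trivial⟩
    have h₂ : basicMap c i' y' ∉ D i' := fun h' => hc ((h _ _ _).1 h').1
    refine ⟨m, D, hD, ?_, fun hs => h₂ (hs.1 h₁), fun hs => h₂ (hs.2 h₁)⟩
    rintro j _ j' _ ⟨c, a, b, rfl, rfl, -⟩
    simp [sameSide, h]
  refine separated_of_not_sameSide fun i p i' p' hn => ?_
  obtain ⟨c, y, rfl⟩ := basicMap_surj i p
  obtain ⟨c', y', rfl⟩ := basicMap_surj i' p'
  by_cases hc : c = c'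
  · subst hc
    have hE' : ¬ E i y i' y' := fun h => hn ⟨c, y, y', rfl, rfl, h⟩
    obtain ⟨n, D, hD, hinv, h₁, h₂⟩ := hE _ _ _ _ hE'
    rcases c with _ | e
    · obtain ⟨m, D', hD', hnone, hsome⟩ := exists_detBy_basicMap_none hD
      refine ⟨m, D', hD', ?_, fun hs => h₂ ((hnone _ _).1 (hs.1 ((hnone _ _).2 h₁)))⟩
      rintro j _ j' _ ⟨c, a, b, rfl, rfl, hab⟩
      rcases c with _ | e
      · exact ((hnone _ _).trans (hinv _ _ _ _ hab)).trans (hnone _ _).symm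
      · exact hsome _ _ _ _ _
    · obtain ⟨m, D', hD', h⟩ := exists_detBy_basicMap_some e hD
      refine ⟨m, D', hD', ?_, fun hs => h₂ ((h _ _ _).1 (hs.1 ((h _ _ _).2 ⟨rfl, h₁⟩))).2⟩
      rintro j _ j' _ ⟨c, a, b, rfl, rfl, hab⟩
      exact ((h _ _ _).trans (and_congr Iff.rfl (hinv _ _ _ _ hab))).trans (h _ _ _).symm
  · rcases c with _ | e
    · rcases c' with _ | e
      · exact absurd rfl hc
      · obtain ⟨n, D, hD, h₁, -, h₂⟩ := ne_case e none i' y' i y hc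
        exact ⟨n, D, hD, h₁, h₂⟩
    · obtain ⟨n, D, hD, h₁, h₂, -⟩ := ne_case e c' i y i' y' (Ne.symm hc)
      exact ⟨n, D, hD, h₁, h₂⟩

/-- The basic gadget: `basicMap` with the discrete parameter coded by the first term. -/
def basicGadget (z : NSeq) : ℕ → NSeq → NSeq :=
  basicMap (Denumerable.ofNat (Option (ℕ × List ℕ)) (z 0))

lemma isGadget_basicGadget : IsGadget basicGadget where
  cont := by
    have h : Continuous fun a : (ℕ × ℕ) × NSeq =>
        basicMap (Denumerable.ofNat (Option (ℕ × List ℕ)) a.1.1) a.1.2 a.2 := by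
      refine continuous_prod_of_discrete_left.2 fun a => continuous_pi fun k => ?_
      refine continuous_discrete_rng.2 fun m => isOpen_iff_forall_mem_open.2 fun y hy => ?_
      refine ⟨_, fun y' hy' => ?_, isOpen_agree (k + 1) y, Agree.refl _ _⟩
      exact (basicMap_agree _ _ hy' k k.lt_succ_self).symm.trans hy
    have h' : Continuous fun a : NSeq × ℕ × NSeq => ((a.1 0, a.2.1), a.2.2) := by fun_prop
    exact h.comp h'
  lip _ i _ _ _ h := basicMap_agree _ i h
  inj _ _ _ _ _ h := ⟨(basicMap_inj h).2, congrArg basicMap (basicMap_inj h).1⟩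
  expand _ := basicMap_expand _
  sep E hE := by
    have : Lift basicGadget E = Lift basicMap E := by
      funext i p i' p'
      refine propext ⟨fun ⟨w, h⟩ => ⟨_, h⟩, fun ⟨c, h⟩ => ⟨fun _ => Encodable.encode c, ?_⟩⟩
      simpa [basicGadget] using h
    rw [this]
    exact separated_lift_basicMap hE

end BasicGadget

section Sigma

open Topology Filter

lemma sigma0_one {Z : Type*} [TopologicalSpace Z] {s : Set Z} : s ∈ Sigma0 Z 1 ↔ IsOpen s := by
  rw [Sigma0]
  simp

lemma mem_sigma0_of_one_lt {Z : Type*} [TopologicalSpace Z] {α : Ordinal} (hα : 1 < α)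
    {s : Set Z} : s ∈ Sigma0 Z α ↔ ∃ A : ℕ → Set Z, ∃ β : ℕ → Ordinal,
      (∀ n, 1 ≤ β n ∧ β n < α ∧ A n ∈ Sigma0 Z (β n)) ∧ s = ⋃ n, (A n)ᶜ := by
  rw [Sigma0]
  simp [hα, hα.ne']

lemma sigma0_preimage {Z W : Type*} [TopologicalSpace Z] [TopologicalSpace W] {f : Z → W}
    (hf : Continuous f) {α : Ordinal} (hα : 1 ≤ α) {s : Set W} (hs : s ∈ Sigma0 W α) :
    f ⁻¹' s ∈ Sigma0 Z α := by
  induction α using WellFoundedLT.induction generalizing s with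
  | ind α ih =>
    rcases hα.eq_or_lt with rfl | hα
    · exact sigma0_one.2 ((sigma0_one.1 hs).preimage hf)
    · obtain ⟨A, β, hA, rfl⟩ := (mem_sigma0_of_one_lt hα).1 hs
      refine (mem_sigma0_of_one_lt hα).2 ⟨fun n => f ⁻¹' A n, β, fun n => ⟨(hA n).1, (hA n).2.1,
        ih _ (hA n).2.1 (hA n).1 (hA n).2.2⟩, ?_⟩
      simp

lemma baireMeasurableSet_of_mem_sigma0 {Z : Type*} [TopologicalSpace Z] {α : Ordinal}
    (hα : 1 ≤ α) {s : Set Z} (hs : s ∈ Sigma0 Z α) : BaireMeasurableSet s := by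
  induction α using WellFoundedLT.induction generalizing s with
  | ind α ih =>
    rcases hα.eq_or_lt with rfl | hα
    · exact (sigma0_one.1 hs).baireMeasurableSet
    · obtain ⟨A, β, hA, rfl⟩ := (mem_sigma0_of_one_lt hα).1 hs
      exact .iUnion fun n => (ih _ (hA n).2.1 (hA n).1 (hA n).2.2).compl

lemma compl_mem_sigma0_succ {Z : Type*} [TopologicalSpace Z] {α : Ordinal} (hα : 1 ≤ α)
    {s : Set Z} (hs : s ∈ Sigma0 Z α) : sᶜ ∈ Sigma0 Z (Order.succ α) :=
  (mem_sigma0_of_one_lt (hα.trans_lt (Order.lt_succ α))).2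
    ⟨fun _ => s, fun _ => α, fun _ => ⟨hα, Order.lt_succ α, hs⟩, (Set.iUnion_const _).symm⟩

end Sigma

section Category

open Topology Filter

variable {X Y : Type*} [TopologicalSpace X] [TopologicalSpace Y]

lemma exists_mem_of_eventually_residual [BaireSpace X] {P : X → Prop}
    (h : ∀ᶠ x in residual X, P x) {U : Set X} (hU : IsOpen U) (hne : U.Nonempty) :
    ∃ x ∈ U, P x :=
  (dense_of_mem_residual h).exists_mem_open hU hne |>.imp fun _ h => ⟨h.2, h.1⟩

/-- The section half of the Kuratowski–Ulam theorem. -/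
lemma eventually_residual_prod [SecondCountableTopology Y] {P : X → Y → Prop}
    (h : ∀ᶠ p in residual (X × Y), P p.1 p.2) :
    ∀ᶠ x in residual X, ∀ᶠ y in residual Y, P x y := by
  obtain ⟨S, ho, hd, hc, hS⟩ := mem_residual_iff.1 h
  have main : ∀ O ∈ S, ∀ᶠ x in residual X, ∀ᶠ y in residual Y, (x, y) ∈ O := by
    intro O hO
    have hb : ∀ᶠ x in residual X, ∀ V ∈ TopologicalSpace.countableBasis Y,
        ∃ y ∈ V, (x, y) ∈ O := by
      refine (eventually_countable_ball (TopologicalSpace.countable_countableBasis Y)).2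
        fun V hV => ?_
      have hVo := TopologicalSpace.isOpen_of_mem_countableBasis hV
      have hVn := TopologicalSpace.nonempty_of_mem_countableBasis hV
      have e : {x | ∃ y ∈ V, (x, y) ∈ O} = Prod.fst '' (O ∩ Set.univ ×ˢ V) := by
        ext x
        constructor
        · rintro ⟨y, hy, h⟩
          exact ⟨(x, y), ⟨h, trivial, hy⟩, rfl⟩
        · rintro ⟨⟨x, y⟩, ⟨h, -, hy⟩, rfl⟩
          exact ⟨y, hy, h⟩
      refine residual_of_dense_open ?_ ?_
      · rw [e]
        exact isOpenMap_fst _ ((ho O hO).inter (isOpen_univ.prod hVo))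
      · refine dense_iff_inter_open.2 fun W hW hWn => ?_
        obtain ⟨⟨x, y⟩, ⟨hx, hy⟩, hxy⟩ :=
          (hd O hO).inter_open_nonempty (W ×ˢ V) (hW.prod hVo) (hWn.prod hVn)
        exact ⟨x, hx, y, hy, hxy⟩
    filter_upwards [hb] with x hx
    refine residual_of_dense_open ((ho O hO).preimage (by fun_prop)) ?_
    refine (TopologicalSpace.isBasis_countableBasis Y).dense_iff.2 fun V hV _ => ?_
    obtain ⟨y, hy, hxy⟩ := hx V hV
    exact ⟨y, hy, hxy⟩
  filter_upwards [(eventually_countable_ball hc).2 main] with x hx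
  filter_upwards [(eventually_countable_ball hc).2 hx] with y hy
  exact hS hy

/-- The converse half of the Kuratowski–Ulam theorem, for sets with the Baire property. -/
lemma eventually_residual_of_sections [SecondCountableTopology Y] [BaireSpace X] [BaireSpace Y]
    {P : X → Y → Prop} (hP : BaireMeasurableSet {p : X × Y | P p.1 p.2})
    (h : ∀ᶠ x in residual X, ∀ᶠ y in residual Y, P x y) :
    ∀ᶠ p in residual (X × Y), P p.1 p.2 := by
  obtain ⟨O, hO, hPO⟩ := hP.residualEq_isOpen
  have hPO' := eventuallyEq_set.1 hPO
  have hd : Dense O := by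
    refine dense_iff_inter_open.2 fun W hW ⟨⟨x, y⟩, hxy⟩ => ?_
    obtain ⟨U, V, hU, hV, hx, hy, hUV⟩ := isOpen_prod_iff.1 hW x y hxy
    obtain ⟨a, ha, h₁, h₂⟩ := exists_mem_of_eventually_residual
      (h.and (eventually_residual_prod (P := fun x y => (x, y) ∈ {p : X × Y | P p.1 p.2} ↔
        (x, y) ∈ O) hPO')) hU ⟨x, hx⟩
    obtain ⟨b, hb, h₃, h₄⟩ := exists_mem_of_eventually_residual (h₁.and h₂) hV ⟨y, hy⟩
    exact ⟨(a, b), hUV ⟨ha, hb⟩, h₄.1 h₃⟩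
  filter_upwards [hPO', residual_of_dense_open hO hd] with p h₁ h₂
  exact h₁.2 h₂

lemma eventually_residual_homeomorph (e : X ≃ₜ Y) {P : Y → Prop} :
    (∀ᶠ x in residual X, P (e x)) ↔ ∀ᶠ y in residual Y, P y := by
  rw [← e.residual_map_eq, eventually_map]

/-- A sequence is its first term followed by a sequence. -/
def sconsHomeomorph (X : Type*) [TopologicalSpace X] : X × (ℕ → X) ≃ₜ (ℕ → X) where
  toFun p := scons p.1 p.2
  invFun z := (z 0, stail z)
  left_inv _ := rfl
  right_inv _ := scons_stail _
  continuous_toFun := continuous_scons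
  continuous_invFun := (continuous_apply 0).prodMk continuous_stail

lemma eventually_residual_scons [SecondCountableTopology X] {P : (ℕ → X) → Prop}
    (h : ∀ᶠ z in residual (ℕ → X), P z) :
    ∀ᶠ w in residual X, ∀ᶠ z in residual (ℕ → X), P (scons w z) :=
  eventually_residual_prod ((eventually_residual_homeomorph (sconsHomeomorph X)).2 h)

lemma eventually_residual_scons_swap [SecondCountableTopology X] {P : (ℕ → X) → Prop}
    (h : ∀ᶠ z in residual (ℕ → X), P z) :
    ∀ᶠ z in residual (ℕ → X), ∀ᶠ w in residual X, P (scons w z) :=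
  eventually_residual_prod ((eventually_residual_homeomorph
    ((Homeomorph.prodComm (ℕ → X) X).trans (sconsHomeomorph X))).2 h)

lemma eventually_residual_of_scons [SecondCountableTopology X] [BaireSpace X]
    [BaireSpace (ℕ → X)] {P : (ℕ → X) → Prop} (hP : BaireMeasurableSet {z | P z})
    (h : ∀ᶠ w in residual X, ∀ᶠ z in residual (ℕ → X), P (scons w z)) :
    ∀ᶠ z in residual (ℕ → X), P z := by
  let e := sconsHomeomorph X
  exact (eventually_residual_homeomorph e).1 (eventually_residual_of_sections
    (P := fun w z => P (scons w z)) (hP.preimage e.continuous e.isOpenMap) h)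

lemma eventually_residual_of_scons_swap [SecondCountableTopology X] [BaireSpace X]
    [BaireSpace (ℕ → X)] {P : (ℕ → X) → Prop} (hP : BaireMeasurableSet {z | P z})
    (h : ∀ᶠ z in residual (ℕ → X), ∀ᶠ w in residual X, P (scons w z)) :
    ∀ᶠ z in residual (ℕ → X), P z := by
  let e := (Homeomorph.prodComm (ℕ → X) X).trans (sconsHomeomorph X)
  exact (eventually_residual_homeomorph e).1 (eventually_residual_of_sections
    (P := fun z w => P (scons w z)) (hP.preimage e.continuous e.isOpenMap) h)

lemma exists_scons_mem_of_isOpen {V : Set (ℕ → X)} (hV : IsOpen V) (hne : V.Nonempty) :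
    ∃ V₀ : Set X, ∃ V₁ : Set (ℕ → X), IsOpen V₀ ∧ V₀.Nonempty ∧ IsOpen V₁ ∧ V₁.Nonempty ∧
      ∀ w ∈ V₀, ∀ z ∈ V₁, scons w z ∈ V := by
  obtain ⟨z, hz⟩ := hne
  obtain ⟨V₀, V₁, h₀, h₁, hz₀, hz₁, h⟩ := isOpen_prod_iff.1
    (hV.preimage continuous_scons) (z 0) (stail z) (by simpa using hz)
  exact ⟨V₀, V₁, h₀, ⟨_, hz₀⟩, h₁, ⟨_, hz₁⟩, fun w hw z hz => h (Set.mk_mem_prod hw hz)⟩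

lemma exists_isOpen_subset_indep {V : Set (ℕ → X)} (hV : IsOpen V) (hne : V.Nonempty) :
    ∃ W ⊆ V, IsOpen W ∧ W.Nonempty ∧
      ∃ N, ∀ m ≥ N, ∀ z z' : ℕ → X, (∀ j ≠ m, z j = z' j) → z ∈ W → z' ∈ W := by
  obtain ⟨z, hz⟩ := hne
  obtain ⟨I, u, hu, h⟩ := isOpen_pi_iff.1 hV z hz
  refine ⟨_, h, isOpen_set_pi I.finite_toSet fun i hi => (hu i hi).1,
    ⟨z, fun i hi => (hu i hi).2⟩, I.sup id + 1, fun m hm w w' hww hw i hi => ?_⟩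
  rw [← hww i]
  · exact hw i hi
  · have := Finset.le_sup (f := id) hi
    simp only [id] at this
    omega

end Category

section LowComplexity

open Topology Filter

/-- Avoiding a set of the class `𝒜` for almost all parameters is a closed condition. -/
def IsLow {Z : Type*} [TopologicalSpace Z] (K : Z → ℕ → NSeq → NSeq) (𝒜 : Set (Set NSeq)) : Prop :=
  ∀ i U, IsOpen U → ∀ A ∈ 𝒜, IsClosed {y | ∀ᶠ z in residual Z, z ∈ U → K z i y ∉ A}

lemma IsLow.comp_homeomorph {Z W : Type*} [TopologicalSpace Z] [TopologicalSpace W]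
    {K : Z → ℕ → NSeq → NSeq} {𝒜 : Set (Set NSeq)} (hK : IsLow K 𝒜) (e : W ≃ₜ Z) :
    IsLow (fun w => K (e w)) 𝒜 := by
  intro i U hU A hA
  convert hK i (e.symm ⁻¹' U) (hU.preimage e.symm.continuous) A hA using 3 with y
  rw [← eventually_residual_homeomorph e]
  simp

lemma IsGadget.isLow_sigma0_one {Z : Type*} [TopologicalSpace Z] [BaireSpace Z]
    {K : Z → ℕ → NSeq → NSeq} (hK : IsGadget K) : IsLow K (Sigma0 NSeq 1) := by
  intro i U hU A hA
  have hA := sigma0_one.1 hA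
  have e : {y | ∀ᶠ z in residual Z, z ∈ U → K z i y ∉ A} =
      ⋂ z ∈ U, {y | K z i y ∉ A} := by
    ext y
    simp only [Set.mem_iInter]
    refine ⟨fun h z hz hzA => ?_, fun h => ?_⟩
    · obtain ⟨w, ⟨hw, hwA⟩, hw'⟩ := exists_mem_of_eventually_residual h
        (hU.inter (hA.preimage (hK.cont_left i y))) ⟨z, hz, hzA⟩
      exact hw' hw hwA
    · exact (Eventually.of_forall h : ∀ᶠ z in residual Z, z ∈ U → K z i y ∉ A)
  rw [e]
  refine isClosed_biInter fun z _ => ?_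
  exact (hA.preimage (hK.cont.comp ((continuous_const (y := z)).prodMk
    ((continuous_const (y := i)).prodMk continuous_id)))).isClosed_compl

lemma exists_agree_compInf_of_basicGadget {G : ℕ → NSeq → ℕ → NSeq → NSeq}
    (hG : ∀ n, IsGadget (G n)) (m : ℕ) (hm : G m = basicGadget) {z' : ℕ → NSeq}
    (hz' : z' m 0 = 0) (i : ℕ) {y y' : NSeq} (hy : Agree m y y') (N : ℕ) :
    ∃ z, (∀ j ≠ m, z' j = z j) ∧ Agree N (compInf G z' i y') (compInf G z i y) := by
  induction m generalizing G z' i y y' N with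
  | zero =>
    obtain ⟨t, ht⟩ := exists_insertZero_agree N (compInner G z' i y')
    refine ⟨Function.update z' 0 fun _ => Encodable.encode (some (i, t)),
      fun j hj => (Function.update_of_ne hj _ _).symm, ?_⟩
    rw [compInf_eq hG, compInf_eq hG, hm, basicGadget, basicGadget, hz', Function.update_self,
      Denumerable.ofNat_encode, basicMap_self]
    have h0 : Denumerable.ofNat (Option (ℕ × List ℕ)) 0 = none :=
      Denumerable.ofNat_encode (none : Option (ℕ × List ℕ))
    rw [h0]
    exact (Agree.cons rfl (ht _)).mono N.le_succ
  | succ m ih =>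
    have h0 : y 0 = y' 0 := hy 0 m.succ_pos
    obtain ⟨z, hz, h⟩ := ih (fun n => hG (n + 1)) hm (z' := stail z') hz' (Nat.pair i (y' 0))
      hy.tail N
    refine ⟨scons (z' 0) z, fun j hj => ?_, ?_⟩
    · cases j with
      | zero => rfl
      | succ j => exact hz j fun h => hj (congrArg _ h)
    · rw [compInf_eq hG, compInf_eq hG]
      refine (hG 0).lip _ _ _ _ _ ?_
      refine (Agree.cons h0.symm ?_).mono N.le_succ
      rw [h0]
      exact h

variable {G : ℕ → NSeq → ℕ → NSeq → NSeq}

lemma baireMeasurableSet_compInf (hG : ∀ n, IsGadget (G n)) {γ : Ordinal} (hγ : 1 ≤ γ)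
    {A : Set NSeq} (hA : A ∈ Sigma0 NSeq γ) {V : Set (ℕ → NSeq)} (hV : IsOpen V) (i : ℕ)
    (y : NSeq) : BaireMeasurableSet {z | z ∈ V → compInf G z i y ∉ A} := by
  have h : BaireMeasurableSet ((fun z => compInf G z i y) ⁻¹' A) :=
    baireMeasurableSet_of_mem_sigma0 hγ
      (sigma0_preimage ((IsGadget.compInf hG).cont_left i y) hγ hA)
  convert hV.baireMeasurableSet.compl.union h.compl using 1
  ext z
  exact imp_iff_not_or

lemma exists_subset_avoid_of_isLow_zero (hG : ∀ n, IsGadget (G n))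
    (hb : ∀ N, ∃ m ≥ N, G m = basicGadget) {γ : Ordinal} (hγ : 1 ≤ γ)
    (hlow : IsLow (G 0) (Sigma0 NSeq γ)) (i : ℕ) (y : NSeq) {V : Set (ℕ → NSeq)}
    (hV : IsOpen V) (hne : V.Nonempty) :
    ∃ V' ⊆ V, IsOpen V' ∧ V'.Nonempty ∧ ∃ m, ∀ A ∈ Sigma0 NSeq γ,
      (∀ᶠ z in residual _, z ∈ V → compInf G z i y ∉ A) → ∀ y', Agree m y y' →
        ∀ᶠ z in residual _, z ∈ V' → compInf G z i y' ∉ A := by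
  obtain ⟨V₀, V₁, hV₀, hn₀, hV₁, hn₁, hsub⟩ := exists_scons_mem_of_isOpen hV hne
  obtain ⟨W, hWV, hW, ⟨z₀, hz₀⟩, N, hN⟩ := exists_isOpen_subset_indep hV₁ hn₁
  obtain ⟨m', hm', hGm⟩ := hb (N + 1)
  obtain ⟨m, rfl⟩ : ∃ m, m' = m + 1 := ⟨m' - 1, by omega⟩
  let W' : Set (ℕ → NSeq) := {z | z ∈ W ∧ z m 0 = 0}
  have hW' : IsOpen W' := by
    have h : Continuous fun z : ℕ → NSeq => z m 0 := by fun_prop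
    exact hW.inter ((isOpen_discrete ({0} : Set ℕ)).preimage h)
  let V' : Set (ℕ → NSeq) := {z | z 0 ∈ V₀ ∧ stail z ∈ W'}
  have hV' : IsOpen V' :=
    (hV₀.preimage (continuous_apply 0)).inter (hW'.preimage continuous_stail)
  refine ⟨V', fun z hz => ?_, hV', ?_, m + 1, fun A hA h y' hy' => ?_⟩
  · have := hsub (z 0) hz.1 (stail z) (hWV hz.2.1)
    rwa [scons_stail] at this
  · obtain ⟨w, hw⟩ := hn₀
    refine ⟨scons w (Function.update z₀ m 0), hw, ?_, ?_⟩
    · exact hN m (by omega) z₀ _ (fun j hj => (Function.update_of_ne hj _ _).symm) hz₀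
    · change Function.update z₀ m 0 m 0 = 0
      rw [Function.update_self]
      rfl
  · let C : Set NSeq := {q | ∀ᶠ w in residual NSeq, w ∈ V₀ → G 0 w i q ∉ A}
    have hC : IsClosed C := hlow i V₀ hV₀ A hA
    let inner : (ℕ → NSeq) → NSeq → NSeq := fun z x =>
      scons (x 0) (compInf (stail G) z (Nat.pair i (x 0)) (stail x))
    have inner_cont : Continuous fun z => inner z y :=
      continuous_scons.comp (continuous_const.prodMk
        ((IsGadget.compInf fun n => hG (n + 1)).cont_left _ _))
    have compInf_scons : ∀ w z x, compInf G (scons w z) i x = G 0 w i (inner z x) :=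
      fun w z x => compInf_eq hG _ _ _
    have hinner : ∀ z ∈ V₁, inner z y ∈ C := by
      intro z hz
      by_contra hzC
      have hev : ∀ᶠ z in residual (ℕ → NSeq), z ∈ V₁ → inner z y ∈ C := by
        filter_upwards [eventually_residual_scons_swap h] with z hz hzV
        filter_upwards [hz] with w hw hwV
        rw [← compInf_scons]
        exact hw (hsub w hwV z hzV)
      obtain ⟨z', ⟨h₁, h₂⟩, h₃⟩ := exists_mem_of_eventually_residual hev
        (hV₁.inter (hC.isOpen_compl.preimage inner_cont)) ⟨z, hz, hzC⟩
      exact h₂ (h₃ h₁)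
    refine eventually_residual_of_scons_swap
      (baireMeasurableSet_compInf hG hγ hA hV' i y') (Eventually.of_forall fun z => ?_)
    by_cases hzW : z ∈ W'
    · have hzC : inner z y' ∈ C := by
        by_contra hzC
        obtain ⟨n, hn⟩ := exists_agree_subset hC.isOpen_compl hzC
        obtain ⟨z', hz', hag⟩ := exists_agree_compInf_of_basicGadget
          (fun n => hG (n + 1)) m hGm hzW.2 (Nat.pair i (y' 0)) hy'.tail n
        refine hn (inner z' y) ?_ (hinner z' (hWV (hN m (by omega) z z' hz' hzW.1)))
        have h0 : y 0 = y' 0 := hy' 0 m.succ_pos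
        refine (Agree.cons h0.symm ?_).mono n.le_succ
        rw [h0]
        exact hag
      filter_upwards [hzC] with w hw hwV
      rw [compInf_scons]
      exact hw hwV.1
    · exact Eventually.of_forall fun w hw => absurd hw.2 hzW

lemma exists_subset_avoid_of_isLow (hG : ∀ n, IsGadget (G n))
    (hb : ∀ N, ∃ m ≥ N, G m = basicGadget) {γ : Ordinal} (hγ : 1 ≤ γ) (n : ℕ)
    (hlow : IsLow (G n) (Sigma0 NSeq γ)) (i : ℕ) (y : NSeq) {V : Set (ℕ → NSeq)}
    (hV : IsOpen V) (hne : V.Nonempty) :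
    ∃ V' ⊆ V, IsOpen V' ∧ V'.Nonempty ∧ ∃ m, ∀ A ∈ Sigma0 NSeq γ,
      (∀ᶠ z in residual _, z ∈ V → compInf G z i y ∉ A) → ∀ y', Agree m y y' →
        ∀ᶠ z in residual _, z ∈ V' → compInf G z i y' ∉ A := by
  induction n generalizing G i y V with
  | zero => exact exists_subset_avoid_of_isLow_zero hG hb hγ hlow i y hV hne
  | succ n ih =>
    obtain ⟨V₀, V₁, hV₀, ⟨w₀, hw₀⟩, hV₁, hn₁, hsub⟩ := exists_scons_mem_of_isOpen hV hne
    have hb' : ∀ N, ∃ m ≥ N, stail G m = basicGadget := fun N => by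
      obtain ⟨m, hm, h⟩ := hb (N + 1)
      obtain ⟨k, rfl⟩ : ∃ k, m = k + 1 := ⟨m - 1, by omega⟩
      exact ⟨k, by omega, h⟩
    obtain ⟨W, hWV, hW, ⟨z₀, hz₀⟩, m, hm⟩ := ih (fun n => hG (n + 1)) hb' hlow
      (Nat.pair i (y 0)) (stail y) hV₁ hn₁
    let V' : Set (ℕ → NSeq) := {z | z 0 ∈ V₀ ∧ stail z ∈ W}
    have hV' : IsOpen V' :=
      (hV₀.preimage (continuous_apply 0)).inter (hW.preimage continuous_stail)
    refine ⟨V', fun z hz => ?_, hV', ⟨scons w₀ z₀, hw₀, hz₀⟩, m + 1, fun A hA h y' hy' => ?_⟩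
    · have := hsub (z 0) hz.1 (stail z) (hWV hz.2)
      rwa [scons_stail] at this
    · have h0 : y 0 = y' 0 := hy' 0 m.succ_pos
      refine eventually_residual_of_scons (baireMeasurableSet_compInf hG hγ hA hV' i y') ?_
      filter_upwards [eventually_residual_scons h] with w hw
      by_cases hwV : w ∈ V₀
      · have hφ : Continuous fun p : NSeq => G 0 w i (scons (y 0) p) :=
          (hG 0).cont.comp ((continuous_const (y := w)).prodMk ((continuous_const (y := i)).prodMk
            (continuous_scons.comp ((continuous_const (y := y 0)).prodMk continuous_id))))
        have h₁ := hm _ (sigma0_preimage hφ hγ hA) (by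
          filter_upwards [hw] with z hz hzV hzA
          refine hz (hsub w hwV z hzV) ?_
          rw [compInf_eq hG]
          exact hzA) (stail y') hy'.tail
        filter_upwards [h₁] with z hz hzV hzA
        refine hz hzV.2 ?_
        rw [compInf_eq hG] at hzA
        change G 0 w i (scons (y 0) (compInf (stail G) z (Nat.pair i (y 0)) (stail y'))) ∈ A
        rw [h0]
        exact hzA
      · exact Eventually.of_forall fun z hz => absurd hz.1 hwV

lemma isLow_compInf (hG : ∀ n, IsGadget (G n)) (hb : ∀ N, ∃ m ≥ N, G m = basicGadget)
    {β : Ordinal} (hβ : 1 < β)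
    (hlow : ∀ γ, 1 ≤ γ → γ < β → ∃ n, IsLow (G n) (Sigma0 NSeq γ)) :
    IsLow (compInf G) (Sigma0 NSeq β) := by
  intro i U hU A hA
  obtain ⟨B, γ, hB, rfl⟩ := (mem_sigma0_of_one_lt hβ).1 hA
  rw [← isOpen_compl_iff, isOpen_iff_forall_mem_open]
  intro y hy
  have hex : ∃ k, ¬ ∀ᶠ z in residual (ℕ → NSeq), z ∈ U → compInf G z i y ∈ B k := by
    by_contra hcon
    push Not at hcon
    refine hy ?_
    filter_upwards [eventually_countable_forall.2 hcon] with z hz hzU hzA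
    obtain ⟨k, hk⟩ := Set.mem_iUnion.1 hzA
    exact hk (hz k hzU)
  obtain ⟨k, hk⟩ := hex
  obtain ⟨hγ, hγβ, hBk⟩ := hB k
  obtain ⟨O, hO, hBO⟩ := (baireMeasurableSet_of_mem_sigma0 hγ
    (sigma0_preimage ((IsGadget.compInf hG).cont_left i y) hγ hBk)).compl.residualEq_isOpen
  have hBO' := eventuallyEq_set.1 hBO
  have hne : (U ∩ O).Nonempty := by
    by_contra hemp
    refine hk ?_
    filter_upwards [hBO'] with z hz hzU
    by_contra hzB
    exact hemp ⟨z, hzU, hz.1 hzB⟩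
  obtain ⟨n, hn⟩ := hlow _ hγ hγβ
  obtain ⟨V, hVU, hV, hVne, m, hm⟩ :=
    exists_subset_avoid_of_isLow hG hb hγ n hn i y (hU.inter hO) hne
  refine ⟨_, fun y' hy' hcl => ?_, isOpen_agree m y, Agree.refl _ _⟩
  have h₁ := hm _ hBk (by filter_upwards [hBO'] with z hz hzV using hz.2 hzV.2) y' hy'
  obtain ⟨z, hzV, hz₁, hz₂⟩ := exists_mem_of_eventually_residual
    (h₁.and (show ∀ᶠ z in residual _, z ∈ U → _ from hcl)) hV hVne
  exact hz₂ (hVU hzV).1 (Set.mem_iUnion.2 ⟨k, hz₁ hzV⟩)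

/-- Sequences of elements of Baire space are coded by single elements. -/
def seqHomeomorph : NSeq ≃ₜ (ℕ → NSeq) where
  toFun z n k := z (Nat.pair n k)
  invFun w m := w m.unpair.1 m.unpair.2
  left_inv z := funext fun m => congrArg z (Nat.pair_unpair m)
  right_inv w := by
    funext n k
    simp
  continuous_toFun := continuous_pi fun _ => continuous_pi fun _ => continuous_apply _
  continuous_invFun := continuous_pi fun m =>
    (continuous_apply m.unpair.2).comp (continuous_apply m.unpair.1)

theorem exists_isGadget_isLow (β : Ordinal) (hβ : 1 ≤ β) (hβ' : β < (Cardinal.aleph 1).ord) :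
    ∃ K : NSeq → ℕ → NSeq → NSeq, IsGadget K ∧ IsLow K (Sigma0 NSeq β) := by
  induction β using WellFoundedLT.induction with
  | ind β ih =>
    rcases hβ.eq_or_lt with rfl | hβ
    · exact ⟨basicGadget, isGadget_basicGadget, isGadget_basicGadget.isLow_sigma0_one⟩
    · have hc : (Set.Iio β).Countable := by
        rw [← Cardinal.le_aleph0_iff_set_countable, Cardinal.mk_Iio_ordinal,
          Cardinal.lift_le_aleph0, ← Cardinal.lt_aleph_one_iff]
        exact Cardinal.lt_ord.1 hβ'
      obtain ⟨f, hf⟩ := (hc.mono (s₁ := Set.Ico 1 β) fun γ h => h.2).exists_eq_range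
        ⟨1, le_rfl, hβ⟩
      have hmem : ∀ n, 1 ≤ f n ∧ f n < β := fun n => by
        have : f n ∈ Set.Ico 1 β := hf ▸ Set.mem_range_self n
        exact this
      choose K hK hlow using fun n => ih (f n) (hmem n).2 (hmem n).1 ((hmem n).2.trans hβ')
      let G : ℕ → NSeq → ℕ → NSeq → NSeq := fun n => if Even n then K (n / 2) else basicGadget
      have hG : ∀ n, IsGadget (G n) := fun n => by
        by_cases hn : Even n
        · simpa [G, hn] using hK (n / 2)
        · simpa [G, hn] using isGadget_basicGadget
      refine ⟨fun z => compInf G (seqHomeomorph z),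
        (IsGadget.compInf hG).comp_homeomorph seqHomeomorph,
        (isLow_compInf hG (fun N => ⟨2 * N + 1, by omega, ?_⟩) hβ ?_).comp_homeomorph
          seqHomeomorph⟩
      · simp [G]
      · intro γ h₁ h₂
        obtain ⟨n, rfl⟩ : γ ∈ Set.range f := hf ▸ ⟨h₁, h₂⟩
        exact ⟨2 * n, by simpa [G] using hlow n⟩

end LowComplexity

section Classes

open Topology Filter

/-- The last nonzero term of `y` before position `n`, or `0`. -/
def lastNonzero (y : NSeq) : ℕ → ℕ
  | 0 => 0
  | n + 1 => if y n = 0 then lastNonzero y n else y n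

/-- The sequence recording at each nonzero term of `y` the previous nonzero term. -/
def valueTrace (y : NSeq) (n : ℕ) : ℕ := if y n = 0 then 0 else lastNonzero y n + 1

lemma lastNonzero_congr {y y' : NSeq} {n : ℕ} (h : Agree n y y') :
    lastNonzero y n = lastNonzero y' n := by
  induction n with
  | zero => rfl
  | succ n ih => rw [lastNonzero, lastNonzero, h n n.lt_succ_self, ih (h.mono n.le_succ)]

lemma valueTrace_congr {y y' : NSeq} {n : ℕ} (h : Agree (n + 1) y y') :
    valueTrace y n = valueTrace y' n := by
  rw [valueTrace, valueTrace, h n n.lt_succ_self, lastNonzero_congr (h.mono n.le_succ)]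

lemma lastNonzero_eq {y : NSeq} {n m : ℕ} (hnm : n < m) (hn : y n ≠ 0)
    (h : ∀ k, n < k → k < m → y k = 0) : lastNonzero y m = y n := by
  induction m, hnm using Nat.le_induction with
  | base => exact if_neg hn
  | succ m hm ih =>
    rw [lastNonzero, if_pos (h m hm m.lt_succ_self)]
    exact ih fun k h₁ h₂ => h k h₁ (by omega)

lemma eq_zero_iff_of_valueTrace_eq {y y' : NSeq} (h : valueTrace y = valueTrace y') (n : ℕ) :
    y n = 0 ↔ y' n = 0 := by
  have := congrFun h n
  unfold valueTrace at this
  split_ifs at this <;> simp_all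

lemma eq_zero_of_valueTrace_eq {y y' : NSeq} (h : valueTrace y = valueTrace y') {n : ℕ}
    (hn : y n ≠ y' n) : y n ≠ 0 ∧ ∀ m, n < m → y m = 0 := by
  have hs := eq_zero_iff_of_valueTrace_eq h
  have hy : y n ≠ 0 := fun h0 => hn (h0.trans ((hs n).1 h0).symm)
  refine ⟨hy, fun m => ?_⟩
  induction m using Nat.strong_induction_on with
  | _ m ih =>
    intro hm
    by_contra h0
    have h₁ := lastNonzero_eq hm hy fun k h₁ h₂ => ih k h₂ h₁
    have h₂ := lastNonzero_eq hm (mt (hs n).2 hy) fun k h₁ h₂ => (hs k).1 (ih k h₂ h₁)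
    have h₃ := congrFun h m
    rw [valueTrace, valueTrace, if_neg h0, if_neg (mt (hs m).2 h0), h₁, h₂] at h₃
    exact hn (Nat.succ.inj h₃)

lemma countable_valueTrace_eq (y : NSeq) : {y' | valueTrace y = valueTrace y'}.Countable := by
  refine (Set.countable_range fun p : ℕ × ℕ => Function.update y p.1 p.2).mono fun y' h => ?_
  by_cases hyy : y = y'
  · exact ⟨(0, y 0), by simp [hyy]⟩
  · obtain ⟨n, hn⟩ := Function.ne_iff.1 hyy
    refine ⟨(n, y' n), funext fun m => ?_⟩
    by_cases hm : m = n
    · subst hm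
      simp
    · simp only [Function.update_of_ne hm]
      by_contra hne
      rcases lt_or_gt_of_ne hm with h' | h'
      · exact (eq_zero_of_valueTrace_eq h hn).1 ((eq_zero_of_valueTrace_eq h hne).2 n h')
      · exact (eq_zero_of_valueTrace_eq h hne).1 ((eq_zero_of_valueTrace_eq h hn).2 m h')

lemma exists_agree_valueTrace_isolated (y : NSeq) :
    ∃ N, ∀ y', valueTrace y = valueTrace y' → Agree N y y' → y = y' := by
  by_cases hy : ∃ n, y n ≠ 0 ∧ ∀ m, n < m → y m = 0
  · obtain ⟨n, hn, hz⟩ := hy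
    refine ⟨n + 1, fun y' h hag => funext fun m => ?_⟩
    by_contra hne
    obtain ⟨h₁, h₂⟩ := eq_zero_of_valueTrace_eq h hne
    rcases lt_trichotomy m n with h' | rfl | h'
    · exact hn (h₂ n h')
    · exact hne (hag m m.lt_succ_self)
    · exact h₁ (hz m h')
  · refine ⟨0, fun y' h _ => funext fun m => ?_⟩
    by_contra hne
    exact hy ⟨m, eq_zero_of_valueTrace_eq h hne⟩

lemma exists_injective_valueTrace_eq (x : NSeq) (n : ℕ) :
    ∃ s : ℕ → NSeq, Function.Injective s ∧ (∀ k, Agree n x (s k)) ∧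
      ∀ k, valueTrace (s 0) = valueTrace (s k) := by
  let s : ℕ → NSeq := fun k j => if j < n then x j else if j = n then k + 1 else 0
  have hlt : ∀ k, ∀ j < n, s k j = x j := fun k j hj => if_pos hj
  have hn : ∀ k, s k n = k + 1 := fun k => by simp [s]
  refine ⟨s, fun k k' h => ?_, fun k j hj => (hlt k j hj).symm, fun k => funext fun j => ?_⟩
  · simpa [hn] using congrFun h n
  · have hag : Agree n (s 0) (s k) := fun j hj => (hlt 0 j hj).trans (hlt k j hj).symm
    rcases lt_trichotomy j n with h | rfl | h
    · exact valueTrace_congr (hag.mono h)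
    · rw [valueTrace, valueTrace, hn, hn, lastNonzero_congr hag]
      simp
    · have : ∀ k, s k j = 0 := fun k => by simp [s, h.not_gt, h.ne']
      simp [valueTrace, this]

lemma separated_valueTrace_eq : Separated fun _ y _ y' => valueTrace y = valueTrace y' := by
  intro i p i' p' h
  obtain ⟨n, hn⟩ := Function.ne_iff.1 h
  refine ⟨n + 1, fun _ => {q | valueTrace p n = valueTrace q n}, fun j q q' hq => ?_,
    fun j q j' q' hq => ?_, rfl, hn⟩
  · change _ = _ ↔ _ = _
    rw [valueTrace_congr hq]
  · change _ = _ ↔ _ = _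
    rw [congrFun hq n]

lemma exists_list_agree (n : ℕ) (p : NSeq) :
    ∃ s : List ℕ, s.length = n ∧ Agree n p fun j => s.getD j 0 :=
  ⟨(List.range n).map p, by simp, fun k hk => by simp [List.getD, hk]⟩

lemma exists_continuous_reduction {T : CtxRel} (hT : Separated T) :
    ∃ r : NSeq → ℕ → Bool, Continuous r ∧ ∀ p p', r p = r p' ↔ T 0 p 0 p' := by
  classical
  let R : ℕ → NSeq → NSeq → Prop := fun n p p' => ∀ D, DetBy n D →
    (∀ j q j' q', T j q j' q' → sameSide D j q j' q') → (p ∈ D 0 ↔ p' ∈ D 0)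
  let s : ℕ → List ℕ := Denumerable.ofNat (List ℕ)
  let r : NSeq → ℕ → Bool := fun p k => decide (R (s k).length p fun j => (s k).getD j 0)
  refine ⟨r, continuous_pi fun k => continuous_discrete_rng.2 fun b =>
    isOpen_iff_forall_mem_open.2 fun p hp =>
      ⟨_, fun q hq => ?_, isOpen_agree (s k).length p, Agree.refl _ _⟩,
    fun p p' => ⟨fun h => ?_, fun h => ?_⟩⟩
  · have : R (s k).length p (fun j => (s k).getD j 0) ↔
        R (s k).length q fun j => (s k).getD j 0 :=
      forall₂_congr fun D hD => by rw [hD 0 p q hq]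
    have hr : r p k = r q k := decide_eq_decide.2 this
    exact hr.symm.trans hp
  · by_contra hn
    obtain ⟨n, D, hD, hinv, h₁, h₂⟩ := hT _ _ _ _ hn
    obtain ⟨l, rfl, hl⟩ := exists_list_agree n p
    have hk := congrFun h (Encodable.encode l)
    simp only [r, s, Denumerable.ofNat_encode, decide_eq_decide] at hk
    have h₃ := hk.1 (fun D hD _ => hD 0 _ _ hl) D hD hinv
    exact h₂ (h₃.2 ((hD 0 _ _ hl).1 h₁))
  · refine funext fun k => decide_eq_decide.2 (forall₃_congr fun D hD hinv => ?_)
    rw [show p ∈ D 0 ↔ p' ∈ D 0 from hinv _ _ _ _ h]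

end Classes

/-- For every countable ordinal `α ≥ 1` there is a closed set `F ⊆ 2^ω × ω^ω` with all
sections countable and relatively discrete which cannot be covered by countably many
`Σ⁰_α` sets with compact sections. -/
theorem no_bound_in_Saint_Raymond
    (α : Ordinal) (hα1 : 1 ≤ α) (hα2 : α < (Cardinal.aleph 1).ord) :
    ∃ F : Set ((ℕ → Bool) × (ℕ → ℕ)),
      IsClosed F ∧
      (∀ x : ℕ → Bool, {y : ℕ → ℕ | (x, y) ∈ F}.Countable) ∧
      (∀ (x : ℕ → Bool) (y : ℕ → ℕ), (x, y) ∈ F →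
        ∃ U : Set (ℕ → ℕ), IsOpen U ∧ y ∈ U ∧ U ∩ {v : ℕ → ℕ | (x, v) ∈ F} = {y}) ∧
      ¬ ∃ B : ℕ → Set ((ℕ → Bool) × (ℕ → ℕ)),
          (∀ n : ℕ, B n ⊆ F) ∧ (⋃ n, B n) = F ∧
          (∀ n : ℕ, B n ∈ Sigma0 ((ℕ → Bool) × (ℕ → ℕ)) α) ∧
          (∀ (n : ℕ) (x : ℕ → Bool), IsCompact {y : ℕ → ℕ | (x, y) ∈ B n}) := by
  obtain ⟨K, hK, hlow⟩ := exists_isGadget_isLow (Order.succ α) (hα1.trans (Order.le_succ α))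
    ((Cardinal.isSuccLimit_ord (Cardinal.aleph0_le_aleph 1)).succ_lt hα2)
  obtain ⟨r, hr, hrT⟩ := exists_continuous_reduction (hK.sep _ separated_valueTrace_eq)
  have hrK : ∀ z y p, r (K z 0 y) = r p ↔ ∃ y', p = K z 0 y' ∧ valueTrace y = valueTrace y' := by
    intro z y p
    rw [hrT]
    constructor
    · rintro ⟨w, a, b, ha, rfl, hab⟩
      obtain ⟨rfl, hKw⟩ := hK.inj _ _ _ _ _ ha
      exact ⟨b, by rw [hKw], hab⟩
    · rintro ⟨y', rfl, h⟩
      exact ⟨z, y, y', rfl, rfl, h⟩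
  have hiso : ∀ (x : ℕ → Bool) (p : NSeq), x = r p →
      ∃ U : Set NSeq, IsOpen U ∧ p ∈ U ∧ U ∩ {q | x = r q} = {p} := by
    rintro _ p rfl
    obtain ⟨z, y, rfl⟩ := hK.surj 0 p
    obtain ⟨n, hn⟩ := exists_agree_valueTrace_isolated y
    obtain ⟨N, hN⟩ := hK.expand z 0 y n
    refine ⟨_, isOpen_agree N _, Agree.refl _ _, Set.eq_singleton_iff_unique_mem.2
      ⟨⟨Agree.refl _ _, rfl⟩, ?_⟩⟩
    rintro q ⟨hq, hrq⟩
    obtain ⟨y', rfl, hy'⟩ := (hrK _ _ _).1 hrq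
    rw [hn y' hy' (hN y' hq)]
  refine ⟨{a | a.1 = r a.2}, isClosed_eq continuous_fst (hr.comp continuous_snd), fun x => ?_,
    hiso, ?_⟩
  · by_cases hx : ∃ p, x = r p
    · obtain ⟨p, rfl⟩ := hx
      obtain ⟨z, y, rfl⟩ := hK.surj 0 p
      refine ((countable_valueTrace_eq y).image (K z 0)).mono fun q hq => ?_
      obtain ⟨y', rfl, hy'⟩ := (hrK _ _ _).1 hq
      exact ⟨y', hy', rfl⟩
    · exact (Set.countable_empty).mono fun p hp => hx ⟨p, hp⟩
  rintro ⟨B, hBF, hBU, hBα, hBc⟩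
  let A : ℕ → Set NSeq := fun n => (fun p => (r p, p)) ⁻¹' B n
  have hA : ∀ n, A n ∈ Sigma0 NSeq α :=
    fun n => sigma0_preimage (hr.prodMk continuous_id) hα1 (hBα n)
  let C : ℕ × TopologicalSpace.countableBasis NSeq → Set NSeq := fun a =>
    {y | ∀ᶠ z in residual NSeq, z ∈ a.2.1 → K z 0 y ∉ (A a.1)ᶜ}
  have hC : ∀ a, IsClosed (C a) := fun a =>
    hlow 0 _ (TopologicalSpace.isOpen_of_mem_countableBasis a.2.2) _
      (compl_mem_sigma0_succ hα1 (hA a.1))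
  have hCU : ⋃ a, C a = Set.univ := by
    refine Set.eq_univ_of_forall fun y => ?_
    have hex : ∃ n, ¬ ∀ᶠ z in residual NSeq, K z 0 y ∉ A n := by
      by_contra hcon
      push Not at hcon
      obtain ⟨z, -, hz⟩ := exists_mem_of_eventually_residual (eventually_countable_forall.2 hcon)
        isOpen_univ Set.univ_nonempty
      have : (r (K z 0 y), K z 0 y) ∈ ⋃ n, B n := by
        rw [hBU]
        rfl
      obtain ⟨n, hn⟩ := Set.mem_iUnion.1 this
      exact hz n hn
    obtain ⟨n, hn⟩ := hex
    obtain ⟨O, hO, hAO⟩ := (baireMeasurableSet_of_mem_sigma0 hα1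
      (sigma0_preimage (hK.cont_left 0 y) hα1 (hA n))).residualEq_isOpen
    have hAO' := Filter.eventuallyEq_set.1 hAO
    have hne : O.Nonempty := by
      by_contra hemp
      refine hn ?_
      filter_upwards [hAO'] with z hz hzA
      exact hemp ⟨z, hz.1 hzA⟩
    obtain ⟨z, hz⟩ := hne
    obtain ⟨U, hU, -, hUO⟩ :=
      (TopologicalSpace.isBasis_countableBasis NSeq).exists_subset_of_mem_open hz hO
    refine Set.mem_iUnion.2 ⟨(n, ⟨U, hU⟩), ?_⟩
    change ∀ᶠ z in residual NSeq, z ∈ U → K z 0 y ∉ (A n)ᶜ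
    filter_upwards [hAO'] with z hz hzU hzA
    exact hzA (hz.2 (hUO hzU))
  obtain ⟨⟨n, U, hU⟩, x, hx⟩ := nonempty_interior_of_iUnion_of_closed hC hCU
  obtain ⟨N, hN⟩ := exists_agree_subset isOpen_interior hx
  obtain ⟨s, hs, hxs, hst⟩ := exists_injective_valueTrace_eq x N
  have hsC : ∀ k, ∀ᶠ z in residual NSeq, z ∈ U → K z 0 (s k) ∉ (A n)ᶜ :=
    fun k => by
      have h : s k ∈ C (n, ⟨U, hU⟩) := interior_subset (hN _ (hxs k))
      exact h
  obtain ⟨z, hzU, hz⟩ := exists_mem_of_eventually_residual (eventually_countable_forall.2 hsC)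
    (TopologicalSpace.isOpen_of_mem_countableBasis hU)
    (TopologicalSpace.nonempty_of_mem_countableBasis hU)
  let b : ℕ → Bool := r (K z 0 (s 0))
  have hmem : ∀ k, K z 0 (s k) ∈ {y : ℕ → ℕ | (b, y) ∈ B n} := by
    intro k
    have h₁ : (r (K z 0 (s k)), K z 0 (s k)) ∈ B n := not_not.1 (hz k hzU)
    have h₂ : b = r (K z 0 (s k)) := (hrK _ _ _).2 ⟨s k, rfl, hst k⟩
    change (b, _) ∈ B n
    rw [h₂]
    exact h₁
  have hdisc : IsDiscrete {y : ℕ → ℕ | (b, y) ∈ B n} := by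
    refine IsDiscrete.mono (isDiscrete_iff_forall_mem_exists_isOpen.2 fun y hy => ?_)
      (fun y hy => show b = r y from hBF n hy)
    obtain ⟨V, hV, -, h⟩ := hiso b y hy
    exact ⟨V, hV, h⟩
  exact Set.infinite_of_injective_forall_mem
    (fun k k' h => hs (hK.inj _ _ _ _ _ h).1) hmem ((hBc n b).finite hdisc)
end

section
/- For every ordinal α with 1 ≤ α < ω₁ there exists a G_δ set G ⊆ 2^ω × 2^ω such that for every x ∈ 2^ω the section G_x is countable and relatively discrete (every point of G_x is isolated in the subspace G_x of 2^ω), and there is no sequence (B(n))_{n∈ℕ} of subsets of G with ⋃_{n∈ℕ} B(n) = G such that each B(n) belongs to the additive Borel class Σ⁰_α(2^ω × 2^ω) and for every n ∈ ℕ and every x ∈ 2^ω the section B(n)_x is a closed subset of 2^ω. -/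
section

open Set Filter Topology Ordinal

namespace SaintRaymond

universe u

/-- An enumeration by natural numbers of the ordinals `≤ Ω`, with a marked ordinal `η < Ω`. -/
structure TagSystem where
  /-- The ordinal named by a tag. -/
  o : ℕ → Ordinal.{u}
  /-- The largest ordinal that is named. -/
  Ω : Ordinal.{u}
  /-- The ordinal marking the roots of the trees that are not forced to be ill-founded. -/
  η : Ordinal.{u}
  inj : Function.Injective o
  le : ∀ t, o t ≤ Ω
  surj : ∀ β ≤ Ω, ∃ t, o t = β
  lt : η < Ω

/-- The parent of a node of the tree structure on `ℕ` with root `0`. -/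
def par (s : ℕ) : ℕ := (Nat.unpair (s - 1)).2

theorem par_lt {s : ℕ} (hs : 0 < s) : par s < s := by
  have := Nat.unpair_right_le (s - 1)
  unfold par
  omega

theorem exists_child (N s : ℕ) : ∃ s', N ≤ s' ∧ 0 < s' ∧ par s' = s :=
  ⟨Nat.pair N s + 1, (Nat.left_le_pair N s).trans (Nat.le_succ _), Nat.succ_pos _, by simp [par]⟩

/-- Points of the forcing space: a function `ℕ → ℕ` together with a tag for each triple. -/
abbrev Pt : Type := (ℕ ⊕ ℕ × ℕ × ℕ) → ℕ

/-- The function coded by a point. -/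
def Pt.m (z : Pt) (k : ℕ) : ℕ := z (Sum.inl k)

/-- The tag trees coded by a point. -/
def Pt.a (z : Pt) (i j s : ℕ) : ℕ := z (Sum.inr (i, j, s))

/-- The point with given function and given tag trees. -/
def Pt.mk (m : ℕ → ℕ) (a : ℕ → ℕ → ℕ → ℕ) : Pt := Sum.elim m fun p => a p.1 p.2.1 p.2.2

@[simp] theorem Pt.mk_m (m : ℕ → ℕ) (a : ℕ → ℕ → ℕ → ℕ) : (Pt.mk m a).m = m := rfl

@[simp] theorem Pt.mk_a (m : ℕ → ℕ) (a : ℕ → ℕ → ℕ → ℕ) : (Pt.mk m a).a = a := rfl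

/-- The pair coded by `i` belongs to the graph of `m`. -/
def OnGraph (m : ℕ → ℕ) (i : ℕ) : Prop := m (Nat.unpair i).1 = (Nat.unpair i).2

/-- The tags of the tree with indices `i`, `j` are visible relative to `M`. -/
def Vis (M : ℕ → Prop) (i j : ℕ) : Prop :=
  (Nat.unpair i).1 ≠ (Nat.unpair j).1 ∧ (M i ↔ M j)

/-- Two points agree up to `n`. -/
def Agree (n : ℕ) (g z : Pt) : Prop :=
  (∀ k < n, g.m k = z.m k) ∧ ∀ i < n, ∀ j < n, ∀ s < n, g.a i j s = z.a i j s

theorem Agree.refl (n : ℕ) (g : Pt) : Agree n g g := ⟨fun _ _ => rfl, fun _ _ _ _ _ _ => rfl⟩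

theorem Agree.symm {n : ℕ} {g z : Pt} (h : Agree n g z) : Agree n z g :=
  ⟨fun k hk => (h.1 k hk).symm, fun i hi j hj s hs => (h.2 i hi j hj s hs).symm⟩

theorem Agree.trans {n : ℕ} {f g h : Pt} (h₁ : Agree n f g) (h₂ : Agree n g h) : Agree n f h :=
  ⟨fun k hk => (h₁.1 k hk).trans (h₂.1 k hk),
    fun i hi j hj s hs => (h₁.2 i hi j hj s hs).trans (h₂.2 i hi j hj s hs)⟩

theorem Agree.mono {n n' : ℕ} {g z : Pt} (h : Agree n' g z) (hn : n ≤ n') : Agree n g z :=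
  ⟨fun k hk => h.1 k (hk.trans_le hn), fun i hi j hj s hs =>
    h.2 i (hi.trans_le hn) j (hj.trans_le hn) s (hs.trans_le hn)⟩

theorem isOpen_agree (n : ℕ) (g : Pt) : IsOpen {z : Pt | Agree n g z} := by
  have h : {z : Pt | Agree n g z} = (⋂ k ∈ Iio n, {z : Pt | g.m k = z (Sum.inl k)}) ∩
      ⋂ i ∈ Iio n, ⋂ j ∈ Iio n, ⋂ s ∈ Iio n, {z : Pt | g.a i j s = z (Sum.inr (i, j, s))} := by
    ext z
    simp [Agree, Pt.m, Pt.a]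
  have key : ∀ c v, IsOpen {z : Pt | v = z c} := fun c v =>
    (isOpen_discrete {w : ℕ | v = w}).preimage (continuous_apply c)
  rw [h]
  exact ((finite_Iio n).isOpen_biInter fun _ _ => key _ _).inter
    ((finite_Iio n).isOpen_biInter fun _ _ => (finite_Iio n).isOpen_biInter fun _ _ =>
      (finite_Iio n).isOpen_biInter fun _ _ => key _ _)

theorem exists_agree_subset {O : Set Pt} (hO : IsOpen O) {z : Pt} (hz : z ∈ O) :
    ∃ n, ∀ z', Agree n z z' → z' ∈ O := by
  obtain ⟨I, v, hv, hsub⟩ := isOpen_pi_iff.1 hO z hz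
  let size : ℕ ⊕ ℕ × ℕ × ℕ → ℕ := Sum.elim id fun p => max p.1 (max p.2.1 p.2.2)
  refine ⟨I.sup size + 1, fun z' h => hsub ?_⟩
  intro c hc
  have hle : size c ≤ I.sup size := Finset.le_sup hc
  have hzc : z c = z' c := by
    rcases c with k | ⟨i, j, s⟩
    · exact h.1 k (Nat.lt_succ_of_le hle)
    · have h' : max i (max j s) ≤ I.sup size := hle
      exact h.2 i (by omega) j (by omega) s (by omega)
  exact hzc ▸ (hv c hc).2

theorem onGraph_congr {n i : ℕ} {m m' : ℕ → ℕ} (h : ∀ k < n, m k = m' k) (hi : i < n) :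
    OnGraph m i ↔ OnGraph m' i := by
  unfold OnGraph
  rw [h _ ((Nat.unpair_left_le i).trans_lt hi)]

theorem vis_congr {n i j : ℕ} {m m' : ℕ → ℕ} (h : ∀ k < n, m k = m' k) (hi : i < n) (hj : j < n) :
    Vis (OnGraph m) i j ↔ Vis (OnGraph m') i j := by
  unfold Vis
  rw [onGraph_congr h hi, onGraph_congr h hj]

/-- The thresholds of the approximation relations. -/
noncomputable def thr (γ : Ordinal.{u}) : Ordinal.{u} := ω * γ + 1

theorem thr_add_omega_le {δ γ : Ordinal.{u}} (h : δ < γ) : thr δ + ω ≤ thr γ := by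
  have h1 : thr δ + ω = ω * (δ + 1) := by
    rw [thr, add_assoc, one_add_omega0, mul_add, mul_one]
  rw [h1, thr]
  exact (mul_le_mul_right (Order.add_one_le_of_lt h) ω).trans le_self_add

namespace TagSystem

variable (T : TagSystem.{u})

/-- A name for an ordinal `≤ Ω`. -/
noncomputable def code (β : Ordinal.{u}) : ℕ :=
  open Classical in if h : β ≤ T.Ω then (T.surj β h).choose else 0

theorem o_code {β : Ordinal.{u}} (h : β ≤ T.Ω) : T.o (T.code β) = β := by
  rw [code, dif_pos h]
  exact (T.surj β h).choose_spec

@[simp] theorem o_code_zero : T.o (T.code 0) = 0 := T.o_code zero_le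

/-- `b` is a tagging with root tag `r`: tags decrease strictly along the tree, except that `0`
may be followed by `0` and `Ω` by `Ω`. -/
def IsTagging (r : Ordinal.{u}) (b : ℕ → ℕ) : Prop :=
  T.o (b 0) = r ∧ ∀ s > 0, T.o (b s) = 0 ∨ T.o (b s) < T.o (b (par s)) ∨
    (T.o (b s) = T.Ω ∧ T.o (b (par s)) = T.Ω)

/-- The tagging with only the root alive. -/
noncomputable def rootOnly (r : Ordinal.{u}) (s : ℕ) : ℕ := if s = 0 then T.code r else T.code 0

theorem isTagging_rootOnly {r : Ordinal.{u}} (hr : r ≤ T.Ω) : T.IsTagging r (T.rootOnly r) := by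
  refine ⟨by simp [rootOnly, T.o_code hr], fun s hs => Or.inl ?_⟩
  simp [rootOnly, hs.ne']

variable {T}

theorem IsTagging.exists_retag {r r' θ : Ordinal.{u}} {h v : ℕ → ℕ} (hh : T.IsTagging r h)
    (hv : T.IsTagging r' v) {N : ℕ} (hN : 0 < N) (hθ : θ + ω ≤ T.Ω)
    (hs : ∀ s < N, h s = v s ∨ θ + ω ≤ T.o (h s) ∧ θ + ω ≤ T.o (v s)) (n : ℕ) :
    ∃ b, T.IsTagging r' b ∧ (∀ s < N, b s = v s) ∧
      ∀ s < n, h s = b s ∨ θ ≤ T.o (h s) ∧ θ ≤ T.o (b s) := by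
  let b : ℕ → ℕ := fun s => if s < N then v s else
    if s < n then T.code (min (T.o (h s)) (θ + ((n - s : ℕ) : Ordinal.{u}))) else T.code 0
  have hb1 : ∀ s < N, b s = v s := fun s hs => if_pos hs
  have hb2 : ∀ s, ¬ s < N → s < n → T.o (b s) = min (T.o (h s)) (θ + ((n - s : ℕ) : Ordinal.{u})) := by
    intro s h1 h2
    simp only [b, if_neg h1, if_pos h2]
    exact T.o_code ((min_le_left _ _).trans (T.le _))
  have hb3 : ∀ s, ¬ s < N → ¬ s < n → T.o (b s) = 0 := by
    intro s h1 h2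
    simp only [b, if_neg h1, if_neg h2, o_code_zero]
  have hk : ∀ k : ℕ, θ + (k : Ordinal.{u}) < θ + ω := fun k =>
    (add_lt_add_iff_left θ).2 (natCast_lt_omega0 k)
  refine ⟨b, ⟨by rw [hb1 0 hN]; exact hv.1, fun s hs0 => ?_⟩, hb1, fun s hsn => ?_⟩
  · by_cases h1 : s < N
    · rw [hb1 s h1, hb1 _ ((par_lt hs0).trans h1)]
      exact hv.2 s hs0
    by_cases h2 : s < n
    swap
    · exact Or.inl (hb3 s h1 h2)
    rw [hb2 s h1 h2]
    have hp := par_lt hs0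
    by_cases h3 : par s < N
    · rw [hb1 _ h3]
      rcases hs _ h3 with he | ⟨-, he⟩
      · rw [← he]
        rcases hh.2 s hs0 with h0 | hlt | ⟨-, hΩ⟩
        · left; simp [h0]
        · exact Or.inr (Or.inl ((min_le_left _ _).trans_lt hlt))
        · rw [hΩ]
          exact Or.inr (Or.inl ((min_le_right _ _).trans_lt ((hk _).trans_le hθ)))
      · exact Or.inr (Or.inl ((min_le_right _ _).trans_lt ((hk _).trans_le he)))
    · rw [hb2 _ h3 (hp.trans h2)]
      have hlt : θ + ((n - s : ℕ) : Ordinal.{u}) < θ + ((n - par s : ℕ) : Ordinal.{u}) := by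
        rw [add_lt_add_iff_left, Nat.cast_lt]
        omega
      rcases hh.2 s hs0 with h0 | hlt' | ⟨-, hΩ⟩
      · left; simp [h0]
      · exact Or.inr (Or.inl (min_lt_min hlt' hlt))
      · refine Or.inr (Or.inl (lt_min ?_ ((min_le_right _ _).trans_lt hlt)))
        rw [hΩ]
        exact (min_le_right _ _).trans_lt ((hk _).trans_le hθ)
  · by_cases h1 : s < N
    · rw [hb1 s h1]
      exact (hs s h1).imp_right fun h => ⟨le_self_add.trans h.1, le_self_add.trans h.2⟩
    · have := hb2 s h1 hsn
      rcases le_total (T.o (h s)) (θ + ((n - s : ℕ) : Ordinal.{u})) with hle | hle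
      · rw [min_eq_left hle] at this
        exact Or.inl (T.inj this.symm)
      · rw [min_eq_right hle] at this
        exact Or.inr ⟨le_self_add.trans hle, this ▸ le_self_add⟩

variable (T)

open Classical in
/-- The prescribed root tags. -/
noncomputable def rootTag (L : Set ℕ) (m : ℕ → ℕ) (i j : ℕ) : Ordinal.{u} :=
  if ((Nat.unpair i).1 ∈ L ∨ OnGraph m i) ∧ ((Nat.unpair j).1 ∈ L ∨ OnGraph m j) then T.Ω else T.η

theorem rootTag_le (L : Set ℕ) (m : ℕ → ℕ) (i j : ℕ) : T.rootTag L m i j ≤ T.Ω := by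
  unfold rootTag
  split_ifs
  exacts [le_rfl, T.lt.le]

theorem le_rootTag (L : Set ℕ) (m : ℕ → ℕ) (i j : ℕ) : T.η ≤ T.rootTag L m i j := by
  unfold rootTag
  split_ifs
  exacts [T.lt.le, le_rfl]

theorem rootTag_congr {n i j : ℕ} (L : Set ℕ) {m m' : ℕ → ℕ} (h : ∀ k < n, m k = m' k)
    (hi : i < n) (hj : j < n) : T.rootTag L m i j = T.rootTag L m' i j := by
  unfold rootTag
  rw [onGraph_congr h hi, onGraph_congr h hj]

open Classical in
theorem rootTag_of_vis {L : Set ℕ} (hL : L.Subsingleton) {m : ℕ → ℕ} {i j : ℕ}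
    (h : Vis (OnGraph m) i j) : T.rootTag L m i j = if OnGraph m i then T.Ω else T.η := by
  unfold rootTag
  congr 1
  have h1 := h.1
  have h2 := h.2
  have h3 : ¬ ((Nat.unpair i).1 ∈ L ∧ (Nat.unpair j).1 ∈ L) := fun hh => h1 (hL hh.1 hh.2)
  rw [eq_iff_iff]
  tauto

/-- The points all of whose tag trees are taggings with the prescribed root tags. -/
def Z (L : Set ℕ) : Set Pt := {z | ∀ i j, T.IsTagging (T.rootTag L z.m i j) (z.a i j)}

/-- The approximation relation of level `γ`. -/
def E (γ : Ordinal.{u}) (n : ℕ) (g g' : Pt) : Prop :=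
  (∀ k < n, g.m k = g'.m k) ∧ ∀ i < n, ∀ j < n, ∀ s < n,
    (Vis (OnGraph g.m) i j → g.a i j s = g'.a i j s) ∧
    (g.a i j s = g'.a i j s ∨ thr γ ≤ T.o (g.a i j s) ∧ thr γ ≤ T.o (g'.a i j s))

variable {T}

theorem E.symm {γ : Ordinal.{u}} {n : ℕ} {g g' : Pt} (h : T.E γ n g g') : T.E γ n g' g := by
  refine ⟨fun k hk => (h.1 k hk).symm, fun i hi j hj s hs => ⟨fun hv => ?_, ?_⟩⟩
  · exact ((h.2 i hi j hj s hs).1 ((vis_congr h.1 hi hj).2 hv)).symm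
  · exact (h.2 i hi j hj s hs).2.imp Eq.symm And.symm

theorem E_of_agree {n : ℕ} {g g' : Pt} (h : Agree n g g') (γ : Ordinal.{u}) : T.E γ n g g' :=
  ⟨h.1, fun i hi j hj s hs => ⟨fun _ => h.2 i hi j hj s hs, Or.inl (h.2 i hi j hj s hs)⟩⟩

theorem E.exists_extension {κ γ δ : Ordinal.{u}} (hκ : thr κ ≤ T.η) (hγ : γ ≤ κ) (hδ : δ < γ)
    {L L' : Set ℕ} (hL : L.Subsingleton) (hL' : L'.Subsingleton) {n : ℕ} {g g' : Pt}
    (hg' : g' ∈ T.Z L') (hE : T.E γ n g g') (n' : ℕ)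
    {h : Pt} (hh : h ∈ T.Z L) (hgh : Agree n g h) :
    ∃ h' ∈ T.Z L', Agree n g' h' ∧ T.E δ n' h h' := by
  have hη : thr δ + ω ≤ T.η := (thr_add_omega_le (hδ.trans_le hγ)).trans hκ
  have hΩ : thr δ + ω ≤ T.Ω := hη.trans T.lt.le
  have hm : ∀ k < n, g'.m k = h.m k := fun k hk => (hE.1 k hk).symm.trans (hgh.1 k hk)
  have key : ∀ i j, ∃ b, T.IsTagging (T.rootTag L' h.m i j) b ∧
      (i < n → j < n → ∀ s < n, g'.a i j s = b s) ∧
      ∀ s < n', (Vis (OnGraph h.m) i j → h.a i j s = b s) ∧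
        (h.a i j s = b s ∨ thr δ ≤ T.o (h.a i j s) ∧ thr δ ≤ T.o (b s)) := by
    intro i j
    by_cases hv : Vis (OnGraph h.m) i j
    · refine ⟨h.a i j, ?_, fun hi hj s hs => ?_, fun s _ => ⟨fun _ => rfl, Or.inl rfl⟩⟩
      · rw [T.rootTag_of_vis hL' hv, ← T.rootTag_of_vis hL hv]
        exact hh i j
      · rw [← hgh.2 i hi j hj s hs]
        exact ((hE.2 i hi j hj s hs).1 ((vis_congr hgh.1 hi hj).2 hv)).symm
    · by_cases hij : i < n ∧ j < n
      · obtain ⟨hi, hj⟩ := hij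
        have h1 := hg' i j
        rw [T.rootTag_congr L' hm hi hj] at h1
        obtain ⟨b, hb1, hb2, hb3⟩ := (hh i j).exists_retag h1 (by omega : 0 < n) hΩ
          (fun s hs => by
            rw [← hgh.2 i hi j hj s hs]
            exact (hE.2 i hi j hj s hs).2.imp_right fun h =>
              ⟨(thr_add_omega_le hδ).trans h.1, (thr_add_omega_le hδ).trans h.2⟩) n'
        exact ⟨b, hb1, fun _ _ s hs => (hb2 s hs).symm,
          fun s hs => ⟨fun h => absurd h hv, hb3 s hs⟩⟩
      · have h1 := T.isTagging_rootOnly (T.rootTag_le L' h.m i j)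
        obtain ⟨b, hb1, hb2, hb3⟩ := (hh i j).exists_retag h1 one_pos hΩ
          (fun s hs => by
            obtain rfl : s = 0 := by omega
            rw [(hh i j).1, h1.1]
            exact Or.inr ⟨hη.trans (T.le_rootTag _ _ _ _), hη.trans (T.le_rootTag _ _ _ _)⟩) n'
        exact ⟨b, hb1, fun hi hj => absurd ⟨hi, hj⟩ hij,
          fun s hs => ⟨fun h => absurd h hv, hb3 s hs⟩⟩
  choose b hb1 hb2 hb3 using key
  exact ⟨Pt.mk h.m b, hb1, ⟨hm, fun i hi j hj => hb2 i j hi hj⟩,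
    fun _ _ => rfl, fun i _ j _ s hs => hb3 i j s hs⟩

end TagSystem

theorem exists_isOpen_isMeagre_diff {X : Type*} [TopologicalSpace X] {S O : Set X}
    (hS : BaireMeasurableSet S) (hO : IsOpen O) (h : ¬ IsMeagre (O ∩ S)) :
    ∃ V ⊆ O, IsOpen V ∧ V.Nonempty ∧ IsMeagre (V \ S) := by
  obtain ⟨V, hV, hSV⟩ := hS.residualEq_isOpen
  have h1 : IsMeagre (S \ V) := by
    filter_upwards [hSV] with x hx hx'
    exact hx'.2 (hx.mp hx'.1)
  have h2 : IsMeagre (V \ S) := by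
    filter_upwards [hSV] with x hx hx'
    exact hx'.2 (hx.mpr hx'.1)
  refine ⟨O ∩ V, inter_subset_left, hO.inter hV, ?_,
    h2.mono (by exact fun x hx => ⟨hx.1.2, hx.2⟩)⟩
  by_contra hne
  exact h (h1.mono (by exact fun x hx => ⟨hx.2, fun hx' => hne ⟨x, hx.1, hx'⟩⟩))

theorem baireMeasurableSet_preimage_of_mem_Sigma0 {X P : Type*} [TopologicalSpace X]
    [TopologicalSpace P] {f : X → P} (hf : Continuous f) (γ : Ordinal.{u}) :
    ∀ A ∈ Sigma0 P γ, BaireMeasurableSet (f ⁻¹' A) := by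
  induction γ using WellFoundedLT.induction with
  | _ γ ih =>
    intro A hA
    rw [Sigma0] at hA
    rcases hA with ⟨-, hA⟩ | ⟨-, A', β, hβ, rfl⟩
    · exact (hA.preimage hf).baireMeasurableSet
    · rw [preimage_iUnion]
      exact BaireMeasurableSet.iUnion fun n =>
        (ih (β n) (hβ n).2.1 (A' n) (hβ n).2.2).compl

/-- The plane `2^ω × 2^ω`. -/
abbrev Plane : Type := (ℕ → Bool) × (ℕ → Bool)

theorem exists_agree_subset_pi {O : Set (ℕ → Bool)} (hO : IsOpen O) {x : ℕ → Bool} (hx : x ∈ O) :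
    ∃ n, ∀ x' : ℕ → Bool, (∀ c < n, x c = x' c) → x' ∈ O := by
  obtain ⟨I, v, hv, hsub⟩ := isOpen_pi_iff.1 hO x hx
  refine ⟨I.sup id + 1, fun x' h => hsub fun c hc => ?_⟩
  have hle : c ≤ I.sup id := Finset.le_sup (f := id) hc
  exact h c (Nat.lt_succ_of_le hle) ▸ (hv c hc).2

theorem exists_agree_subset_plane {O : Set Plane} (hO : IsOpen O) {p : Plane} (hp : p ∈ O) :
    ∃ n, ∀ q : Plane, (∀ c < n, p.1 c = q.1 c ∧ p.2 c = q.2 c) → q ∈ O := by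
  obtain ⟨V, W, hV, hW, hpV, hpW, hsub⟩ := isOpen_prod_iff.1 hO p.1 p.2 hp
  obtain ⟨n, hn⟩ := exists_agree_subset_pi hV hpV
  obtain ⟨n', hn'⟩ := exists_agree_subset_pi hW hpW
  exact ⟨max n n', fun q h => hsub
    ⟨hn q.1 fun c hc => (h c (lt_max_of_lt_left hc)).1,
      hn' q.2 fun c hc => (h c (lt_max_of_lt_right hc)).2⟩⟩

/-- The first coordinate of the triple coded by `c`. -/
def tri₁ (c : ℕ) : ℕ := (Nat.unpair c).1

/-- The second coordinate of the triple coded by `c`. -/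
def tri₂ (c : ℕ) : ℕ := (Nat.unpair (Nat.unpair c).2).1

/-- The third coordinate of the triple coded by `c`. -/
def tri₃ (c : ℕ) : ℕ := (Nat.unpair (Nat.unpair c).2).2

theorem tri₁_le (c : ℕ) : tri₁ c ≤ c := Nat.unpair_left_le c

theorem tri₂_le (c : ℕ) : tri₂ c ≤ c := (Nat.unpair_left_le _).trans (Nat.unpair_right_le c)

theorem tri₃_le (c : ℕ) : tri₃ c ≤ c := (Nat.unpair_right_le _).trans (Nat.unpair_right_le c)

/-- The code of a triple. -/
def tri (i j s : ℕ) : ℕ := Nat.pair i (Nat.pair j s)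

@[simp] theorem tri₁_tri (i j s : ℕ) : tri₁ (tri i j s) = i := by simp [tri₁, tri]

@[simp] theorem tri₂_tri (i j s : ℕ) : tri₂ (tri i j s) = j := by simp [tri₂, tri]

@[simp] theorem tri₃_tri (i j s : ℕ) : tri₃ (tri i j s) = s := by simp [tri₃, tri]

namespace TagSystem

variable (T : TagSystem.{u})

open Classical in
/-- The point of the plane presented by a point of the forcing space: the first coordinate tells
which tags are alive, the second one is the graph of the function with all visible tags. -/
noncomputable def F (z : Pt) : Plane :=
  (fun c => decide (T.o (z.a (tri₁ c) (tri₂ c) (tri₃ c)) ≠ 0),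
   fun c => if (Nat.unpair c).1 = 0 then decide (OnGraph z.m (Nat.unpair c).2) else
    decide (Vis (OnGraph z.m) (tri₁ (Nat.unpair c).2) (tri₂ (Nat.unpair c).2) ∧
      z.a (tri₁ (Nat.unpair c).2) (tri₂ (Nat.unpair c).2) (tri₃ (Nat.unpair c).2) + 1
        = (Nat.unpair c).1))

variable {T}

theorem E.F_eq {n : ℕ} {g g' : Pt} (h : T.E 0 n g g') :
    ∀ c < n, (T.F g).1 c = (T.F g').1 c ∧ (T.F g).2 c = (T.F g').2 c := by
  intro c hc
  constructor
  · simp only [F, decide_eq_decide]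
    rcases (h.2 _ ((tri₁_le c).trans_lt hc) _ ((tri₂_le c).trans_lt hc) _
      ((tri₃_le c).trans_lt hc)).2 with he | ⟨h1, h2⟩
    · rw [he]
    · have : (0 : Ordinal.{u}) < thr 0 := by simp [thr]
      exact iff_of_true (this.trans_le h1).ne' (this.trans_le h2).ne'
  · have hr : (Nat.unpair c).2 < n := (Nat.unpair_right_le c).trans_lt hc
    simp only [F]
    congr 1
    · rw [decide_eq_decide]
      exact onGraph_congr h.1 hr
    · rw [decide_eq_decide, vis_congr h.1 ((tri₁_le _).trans_lt hr) ((tri₂_le _).trans_lt hr)]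
      refine and_congr_right fun hv => ?_
      rw [(h.2 _ ((tri₁_le _).trans_lt hr) _ ((tri₂_le _).trans_lt hr) _
        ((tri₃_le _).trans_lt hr)).1
        ((vis_congr h.1 ((tri₁_le _).trans_lt hr) ((tri₂_le _).trans_lt hr)).2 hv)]

variable (T)

theorem continuous_F : Continuous T.F := by
  refine continuous_def.2 fun O hO => isOpen_iff_forall_mem_open.2 fun z hz => ?_
  obtain ⟨n, hn⟩ := exists_agree_subset_plane hO hz
  exact ⟨_, fun z' hz' => hn _ (E_of_agree hz' 0).F_eq, isOpen_agree n z, Agree.refl n z⟩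

theorem isClosed_Z (L : Set ℕ) : IsClosed (T.Z L) := by
  have key : ∀ i j s s' (Q : (ℕ → ℕ) → ℕ → ℕ → Prop),
      (∀ m m', m (Nat.unpair i).1 = m' (Nat.unpair i).1 →
        m (Nat.unpair j).1 = m' (Nat.unpair j).1 → ∀ t t', Q m t t' → Q m' t t') →
      IsClosed {z : Pt | Q z.m (z.a i j s) (z.a i j s')} := by
    intro i j s s' Q hQ
    rw [← isOpen_compl_iff]
    refine isOpen_iff_forall_mem_open.2 fun z hz =>
      ⟨_, fun z' hz' => ?_, isOpen_agree (i + j + s + s' + 1) z, Agree.refl _ z⟩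
    intro h
    refine hz ?_
    have h' : Q z'.m (z'.a i j s) (z'.a i j s') := h
    have hi := Nat.unpair_left_le i
    have hj := Nat.unpair_left_le j
    rw [← hz'.2 i (by omega) j (by omega) s (by omega),
      ← hz'.2 i (by omega) j (by omega) s' (by omega)] at h'
    exact hQ _ _ (hz'.1 _ (by omega)).symm (hz'.1 _ (by omega)).symm _ _ h'
  have h : T.Z L = ⋂ i, ⋂ j, ({z : Pt | T.o (z.a i j 0) = T.rootTag L z.m i j} ∩
      ⋂ s, {z : Pt | s > 0 → T.o (z.a i j s) = 0 ∨ T.o (z.a i j s) < T.o (z.a i j (par s)) ∨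
        (T.o (z.a i j s) = T.Ω ∧ T.o (z.a i j (par s)) = T.Ω)}) := by
    ext z
    simp [Z, IsTagging]
  rw [h]
  refine isClosed_iInter fun i => isClosed_iInter fun j => IsClosed.inter ?_
    (isClosed_iInter fun s => ?_)
  · refine key i j 0 0 (fun m t _ => T.o t = T.rootTag L m i j) fun m m' h1 h2 t _ ht => ?_
    rw [ht]
    unfold rootTag OnGraph
    rw [h1, h2]
  · exact key i j s (par s) (fun _ t t' => s > 0 → T.o t = 0 ∨ T.o t < T.o t' ∨
      (T.o t = T.Ω ∧ T.o t' = T.Ω)) fun _ _ _ _ _ _ h => h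

instance (L : Set ℕ) : BaireSpace (T.Z L) := by
  have := (T.isClosed_Z L).polishSpace
  infer_instance

variable {T}

/-- The points of `T.Z L` that agree with `g` up to `n`. -/
def Nb (L : Set ℕ) (n : ℕ) (g : Pt) : Set (T.Z L) := {z | Agree n g z}

theorem isOpen_Nb (L : Set ℕ) (n : ℕ) (g : Pt) : IsOpen (Nb (T := T) L n g) :=
  (isOpen_agree n g).preimage continuous_subtype_val

theorem exists_Nb_isMeagre_diff {L : Set ℕ} {S : Set (T.Z L)} (hS : BaireMeasurableSet S) {n : ℕ}
    {g : Pt} (h : ¬ IsMeagre (Nb L n g ∩ S)) :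
    ∃ h ∈ T.Z L, ∃ n' ≥ n, Agree n g h ∧ IsMeagre (Nb L n' h \ S) := by
  obtain ⟨V, hVg, hVo, ⟨z, hz⟩, hVS⟩ := exists_isOpen_isMeagre_diff hS (isOpen_Nb L n g) h
  obtain ⟨O, hO, rfl⟩ := isOpen_induced_iff.1 hVo
  obtain ⟨n', hn'⟩ := exists_agree_subset hO hz
  refine ⟨z, z.2, max n n', le_max_left _ _, hVg hz,
    hVS.mono (by exact fun z' hz' => ⟨hn' _ (hz'.1.mono (le_max_right _ _)), hz'.2⟩)⟩

theorem not_isMeagre_transfer {κ : Ordinal.{u}} (hκ : thr κ ≤ T.η) (γ : Ordinal.{u}) :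
    γ ≤ κ → ∀ L L' : Set ℕ, L.Subsingleton → L'.Subsingleton → ∀ (n : ℕ) (g g' : Pt),
    g' ∈ T.Z L' → T.E γ n g g' → ∀ A ∈ Sigma0 Plane γ,
    ¬ IsMeagre (Nb L n g ∩ {z : T.Z L | T.F z ∈ A}) →
    ¬ IsMeagre (Nb L' n g' ∩ {z : T.Z L' | T.F z ∈ A}) := by
  induction γ using WellFoundedLT.induction with
  | _ γ ih =>
    intro hγ L L' hL hL' n g g' hg' hE A hA hne
    rw [Sigma0] at hA
    rcases hA with ⟨rfl, hA⟩ | ⟨-, A, β, hβ, rfl⟩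
    · obtain ⟨h, hgh, hhA⟩ := nonempty_of_not_isMeagre hne
      obtain ⟨n', hn'⟩ := exists_agree_subset_plane hA hhA
      obtain ⟨h', hh', hgh', hE'⟩ :=
        hE.exists_extension hκ hγ one_pos hL hL' hg' n' h.2 hgh
      exact not_isMeagre_of_isOpen ((isOpen_Nb L' n g').inter
        (hA.preimage (T.continuous_F.comp continuous_subtype_val)))
        ⟨⟨h', hh'⟩, hgh', hn' _ hE'.F_eq⟩
    · obtain ⟨i, hi⟩ : ∃ i, ¬ IsMeagre (Nb L n g ∩ {z : T.Z L | T.F z ∈ (A i)ᶜ}) := by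
        by_contra! hcon
        refine hne ((isMeagre_iUnion hcon).mono fun z hz => ?_)
        obtain ⟨i, hi⟩ := mem_iUnion.1 hz.2
        exact mem_iUnion.2 ⟨i, hz.1, hi⟩
      obtain ⟨-, hlt, hAi⟩ := hβ i
      have hBM : ∀ L, BaireMeasurableSet {z : T.Z L | T.F z ∈ A i} := fun L =>
        baireMeasurableSet_preimage_of_mem_Sigma0
          (T.continuous_F.comp continuous_subtype_val) _ _ hAi
      obtain ⟨h, hh, n', hnn', hgh, hmeag⟩ := exists_Nb_isMeagre_diff (hBM L).compl hi
      obtain ⟨h', hh', hgh', hE'⟩ := hE.exists_extension hκ hγ hlt hL hL' hg' n' hh hgh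
      have hmeag' : IsMeagre (Nb L' n' h' ∩ {z : T.Z L' | T.F z ∈ A i}) := by
        by_contra hcon
        refine ih (β i) hlt (hlt.le.trans hγ) L' L hL' hL n' h' h hh hE'.symm _ hAi hcon
          (hmeag.mono (by exact fun z hz => ⟨hz.1, fun hz' => hz' hz.2⟩))
      intro hcon
      refine not_isMeagre_of_isOpen (isOpen_Nb L' n' h') ⟨⟨h', hh'⟩, Agree.refl _ _⟩
        ((hmeag'.union hcon).mono fun z hz => ?_)
      by_cases hz' : T.F z ∈ A i
      · exact Or.inl ⟨hz, hz'⟩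
      · exact Or.inr ⟨hgh'.trans (hz.mono hnn'), mem_iUnion.2 ⟨i, hz'⟩⟩

end TagSystem

/-- The index `i` belongs to the graph coded by the second coordinate. -/
def MemGraph (p : Plane) (i : ℕ) : Prop := p.2 (Nat.pair 0 i) = true

/-- The tag at `(i, j, s)` is recorded to be `t` in the second coordinate. -/
def Shows (p : Plane) (i j s t : ℕ) : Prop := p.2 (Nat.pair (t + 1) (tri i j s)) = true

/-- The tag at `(i, j, s)` is recorded to be alive in the first coordinate. -/
def Alive (p : Plane) (i j s : ℕ) : Prop := p.1 (tri i j s) = true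

theorem isClopen_memGraph (i : ℕ) : IsClopen {p : Plane | MemGraph p i} :=
  (isClopen_discrete {true}).preimage ((continuous_apply _).comp continuous_snd)

theorem isClopen_shows (i j s t : ℕ) : IsClopen {p : Plane | Shows p i j s t} :=
  (isClopen_discrete {true}).preimage ((continuous_apply _).comp continuous_snd)

theorem isClopen_alive (i j s : ℕ) : IsClopen {p : Plane | Alive p i j s} :=
  (isClopen_discrete {true}).preimage ((continuous_apply _).comp continuous_fst)

theorem isClopen_imp {X : Type*} [TopologicalSpace X] {P Q : X → Prop} (hP : IsClopen {p | P p})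
    (hQ : IsClopen {p | Q p}) : IsClopen {p | P p → Q p} := by
  have h : {p | P p → Q p} = {p | P p}ᶜ ∪ {p | Q p} := by
    ext p
    simp [imp_iff_not_or]
  rw [h]
  exact hP.compl.union hQ

theorem isOpen_imp {X : Type*} [TopologicalSpace X] {P Q : X → Prop} (hP : IsClopen {p | P p})
    (hQ : IsOpen {p | Q p}) : IsOpen {p | P p → Q p} := by
  have h : {p | P p → Q p} = {p | P p}ᶜ ∪ {p | Q p} := by
    ext p
    simp [imp_iff_not_or]
  rw [h]
  exact hP.compl.isOpen.union hQ

theorem isClopen_const_prop {X : Type*} [TopologicalSpace X] (P : Prop) :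
    IsClopen {_p : X | P} := by
  by_cases h : P <;> simp [h, isClopen_univ, isClopen_empty]

theorem isOpen_const_prop {X : Type*} [TopologicalSpace X] (P : Prop) : IsOpen {_p : X | P} :=
  (isClopen_const_prop P).isOpen

theorem isOpen_exists {X ι : Type*} [TopologicalSpace X] {P : ι → X → Prop}
    (h : ∀ i, IsOpen {p | P i p}) : IsOpen {p | ∃ i, P i p} := by
  have he : {p | ∃ i, P i p} = ⋃ i, {p | P i p} := by
    ext p
    simp
  rw [he]
  exact isOpen_iUnion h

theorem isClopen_vis (i j : ℕ) : IsClopen {p : Plane | Vis (MemGraph p) i j} := by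
  by_cases h : (Nat.unpair i).1 = (Nat.unpair j).1
  · simp [Vis, h, isClopen_empty]
  · have h' : {p : Plane | Vis (MemGraph p) i j} =
        {p | MemGraph p i → MemGraph p j} ∩ {p | MemGraph p j → MemGraph p i} := by
      ext p
      simp [Vis, h, iff_def]
    rw [h']
    exact (isClopen_imp (isClopen_memGraph i) (isClopen_memGraph j)).inter
      (isClopen_imp (isClopen_memGraph j) (isClopen_memGraph i))

namespace TagSystem

variable (T : TagSystem.{u})

/-- The second coordinate codes a function `m` together with all tags visible relative to `m`;
these tags are compatible with the first coordinate, decrease strictly along the trees where they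
are neither `0` nor `Ω`, every smaller tag is reached at a child, and the root tags are the
prescribed ones. -/
structure Good (p : Plane) : Prop where
  total : ∀ k, ∃ v, MemGraph p (Nat.pair k v)
  unique : ∀ k v v', MemGraph p (Nat.pair k v) → MemGraph p (Nat.pair k v') → v = v'
  vis : ∀ i j s t, Shows p i j s t → Vis (MemGraph p) i j
  shows : ∀ i j s, Vis (MemGraph p) i j → ∃ t, Shows p i j s t
  shows_unique : ∀ i j s t t', Shows p i j s t → Shows p i j s t' → t = t'
  alive : ∀ i j s t, T.o t ≠ 0 → Shows p i j s t → Alive p i j s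
  not_alive : ∀ i j s t, T.o t = 0 → Shows p i j s t → Alive p i j s → False
  lt : ∀ i j s t t', 0 < s → 0 < T.o t → T.o t < T.Ω →
    Shows p i j (par s) t → Shows p i j s t' → T.o t' < T.o t
  reach : ∀ i j s t u, T.o u < T.o t → Shows p i j s t →
    ∃ s' t', (0 < s' ∧ par s' = s ∧ T.o u ≤ T.o t') ∧ Shows p i j s' t'
  root : ∀ i j t, MemGraph p i → MemGraph p j → Shows p i j 0 t → T.o t = T.Ω
  root_lt : ∀ i j t, Shows p i j 0 t → T.o t = T.Ω → MemGraph p i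

theorem isGδ_good : IsGδ {p : Plane | T.Good p} := by
  have h : {p : Plane | T.Good p} =
      (⋂ k, {p | ∃ v, MemGraph p (Nat.pair k v)}) ∩
      (⋂ k, ⋂ v, ⋂ v',
        {p | MemGraph p (Nat.pair k v) → MemGraph p (Nat.pair k v') → v = v'}) ∩
      (⋂ i, ⋂ j, ⋂ s, ⋂ t, {p | Shows p i j s t → Vis (MemGraph p) i j}) ∩
      (⋂ i, ⋂ j, ⋂ s, {p | Vis (MemGraph p) i j → ∃ t, Shows p i j s t}) ∩
      (⋂ i, ⋂ j, ⋂ s, ⋂ t, ⋂ t', {p | Shows p i j s t → Shows p i j s t' → t = t'}) ∩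
      (⋂ i, ⋂ j, ⋂ s, ⋂ t, ⋂ (_ : T.o t ≠ 0), {p | Shows p i j s t → Alive p i j s}) ∩
      (⋂ i, ⋂ j, ⋂ s, ⋂ t, ⋂ (_ : T.o t = 0),
        {p | Shows p i j s t → Alive p i j s → False}) ∩
      (⋂ i, ⋂ j, ⋂ s, ⋂ t, ⋂ t', ⋂ (_ : 0 < s), ⋂ (_ : 0 < T.o t), ⋂ (_ : T.o t < T.Ω),
        {p | Shows p i j (par s) t → Shows p i j s t' → T.o t' < T.o t}) ∩
      (⋂ i, ⋂ j, ⋂ s, ⋂ t, ⋂ u, ⋂ (_ : T.o u < T.o t), {p | Shows p i j s t →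
        ∃ s' t', (0 < s' ∧ par s' = s ∧ T.o u ≤ T.o t') ∧ Shows p i j s' t'}) ∩
      (⋂ i, ⋂ j, ⋂ t, {p | MemGraph p i → MemGraph p j → Shows p i j 0 t → T.o t = T.Ω}) ∩
      (⋂ i, ⋂ j, ⋂ t, {p | Shows p i j 0 t → T.o t = T.Ω → MemGraph p i}) := by
    ext p
    simp only [mem_inter_iff, mem_iInter, mem_ofPred_eq]
    constructor
    · rintro ⟨h1, h2, h3, h4, h5, h6, h7, h8, h9, h10, h11⟩
      exact ⟨⟨⟨⟨⟨⟨⟨⟨⟨⟨h1, h2⟩, h3⟩, h4⟩, h5⟩, h6⟩, h7⟩, h8⟩, h9⟩, h10⟩, h11⟩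
    · rintro ⟨⟨⟨⟨⟨⟨⟨⟨⟨⟨h1, h2⟩, h3⟩, h4⟩, h5⟩, h6⟩, h7⟩, h8⟩, h9⟩, h10⟩, h11⟩
      exact ⟨h1, h2, h3, h4, h5, h6, h7, h8, h9, h10, h11⟩
  rw [h]
  refine IsGδ.inter (IsGδ.inter (IsGδ.inter (IsGδ.inter (IsGδ.inter (IsGδ.inter (IsGδ.inter
    (IsGδ.inter (IsGδ.inter (IsGδ.inter ?_ ?_) ?_) ?_) ?_) ?_) ?_) ?_) ?_) ?_) ?_ <;>
    repeat refine IsGδ.iInter fun _ => ?_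
  all_goals refine IsOpen.isGδ ?_
  · exact isOpen_exists fun _ => (isClopen_memGraph _).isOpen
  · exact isOpen_imp (isClopen_memGraph _) (isOpen_imp (isClopen_memGraph _) (isOpen_const_prop _))
  · exact isOpen_imp (isClopen_shows _ _ _ _) (isClopen_vis _ _).isOpen
  · exact isOpen_imp (isClopen_vis _ _) (isOpen_exists fun _ => (isClopen_shows _ _ _ _).isOpen)
  · exact isOpen_imp (isClopen_shows _ _ _ _)
      (isOpen_imp (isClopen_shows _ _ _ _) (isOpen_const_prop _))
  · exact isOpen_imp (isClopen_shows _ _ _ _) (isClopen_alive _ _ _).isOpen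
  · exact isOpen_imp (isClopen_shows _ _ _ _)
      (isOpen_imp (isClopen_alive _ _ _) (isOpen_const_prop _))
  · exact isOpen_imp (isClopen_shows _ _ _ _)
      (isOpen_imp (isClopen_shows _ _ _ _) (isOpen_const_prop _))
  · exact isOpen_imp (isClopen_shows _ _ _ _) (isOpen_exists fun _ => isOpen_exists fun _ =>
      (isOpen_const_prop _).inter (isClopen_shows _ _ _ _).isOpen)
  · exact isOpen_imp (isClopen_memGraph _) (isOpen_imp (isClopen_memGraph _)
      (isOpen_imp (isClopen_shows _ _ _ _) (isOpen_const_prop _)))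
  · exact isOpen_imp (isClopen_shows _ _ _ _)
      (isOpen_imp (isClopen_const_prop _) (isClopen_memGraph _).isOpen)

variable {T}

theorem Good.exists_fun {p : Plane} (h : T.Good p) :
    ∃ m : ℕ → ℕ, ∀ i, MemGraph p i ↔ OnGraph m i := by
  choose m hm using h.total
  refine ⟨m, fun i => ?_⟩
  conv_lhs => rw [← Nat.pair_unpair i]
  exact ⟨fun hi => h.unique _ _ _ (hm _) hi, fun hi => hi ▸ hm _⟩

theorem Good.le_of_shows {p p' : Plane} (h : T.Good p) (h' : T.Good p') (hx : p.1 = p'.1)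
    {i j : ℕ} (γ : Ordinal.{u}) : ∀ s t t', Shows p i j s t → Shows p' i j s t' →
    γ ≤ T.o t → γ ≤ T.o t' := by
  induction γ using WellFoundedLT.induction with
  | _ γ ih =>
    intro s t t' hs hs' hγ
    by_contra! hlt
    have h0 : T.o t' ≠ 0 := by
      intro h0
      refine h'.not_alive _ _ _ _ h0 hs' ?_
      have := h.alive _ _ _ _ ((zero_le.trans_lt hlt).trans_le hγ).ne' hs
      unfold Alive at this ⊢
      rwa [← hx]
    obtain ⟨s', t₁, ⟨hs0, rfl, hle⟩, hs₁⟩ := h.reach i j s t t' (hlt.trans_le hγ) hs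
    obtain ⟨t₂, hs₂⟩ := h'.shows i j s' (h'.vis _ _ _ _ hs')
    exact (ih _ hlt s' t₁ t₂ hs₁ hs₂ hle).not_gt
      (h'.lt _ _ _ _ _ hs0 (pos_iff_ne_zero.2 h0) ((hlt.trans_le hγ).trans_le (T.le t)) hs' hs₂)

theorem Good.eq_of_shows {p p' : Plane} (h : T.Good p) (h' : T.Good p') (hx : p.1 = p'.1)
    {i j s t t' : ℕ} (hs : Shows p i j s t) (hs' : Shows p' i j s t') : t = t' :=
  T.inj ((h.le_of_shows h' hx _ _ _ _ hs hs' le_rfl).antisymm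
    (h'.le_of_shows h hx.symm _ _ _ _ hs' hs le_rfl))

theorem Good.eq_of_ne {p p' : Plane} (h : T.Good p) (h' : T.Good p') (hx : p.1 = p'.1)
    {m m' : ℕ → ℕ} (hm : ∀ i, MemGraph p i ↔ OnGraph m i)
    (hm' : ∀ i, MemGraph p' i ↔ OnGraph m' i) {k k' : ℕ} (hk : m k ≠ m' k)
    (hk' : m k' ≠ m' k') : k = k' := by
  by_contra hne
  have h1 : ¬ MemGraph p (Nat.pair k (m' k)) := by simpa [hm, OnGraph] using hk
  have h2 : ¬ MemGraph p (Nat.pair k' (m' k')) := by simpa [hm, OnGraph] using hk'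
  have h3 : MemGraph p' (Nat.pair k (m' k)) := by simp [hm', OnGraph]
  have h4 : MemGraph p' (Nat.pair k' (m' k')) := by simp [hm', OnGraph]
  obtain ⟨t, ht⟩ := h.shows _ _ 0 ⟨by simpa using hne, iff_of_false h1 h2⟩
  obtain ⟨t', ht'⟩ := h'.shows _ _ 0 ⟨by simpa using hne, iff_of_true h3 h4⟩
  obtain rfl := h.eq_of_shows h' hx ht ht'
  exact h1 (h.root_lt _ _ _ ht (h'.root _ _ _ h3 h4 ht'))

theorem Good.snd_eq {p p' : Plane} (h : T.Good p) (h' : T.Good p') (hx : p.1 = p'.1)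
    (hM : ∀ i, MemGraph p i ↔ MemGraph p' i) : p.2 = p'.2 := by
  have key : ∀ {p p' : Plane}, T.Good p → T.Good p' → p.1 = p'.1 →
      (∀ i, MemGraph p i ↔ MemGraph p' i) → ∀ i j s t, Shows p i j s t → Shows p' i j s t := by
    intro p p' h h' hx hM i j s t hs
    obtain ⟨t', ht'⟩ := h'.shows i j s (by
      have := h.vis _ _ _ _ hs
      unfold Vis at this ⊢
      rwa [← hM, ← hM])
    exact h.eq_of_shows h' hx hs ht' ▸ ht'
  funext c
  rw [← Nat.pair_unpair c]
  rcases (Nat.unpair c).1 with _ | t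
  · exact Bool.eq_iff_iff.2 (hM _)
  · rw [← Nat.pair_unpair (Nat.unpair c).2, ← Nat.pair_unpair (Nat.unpair (Nat.unpair c).2).2]
    exact Bool.eq_iff_iff.2
      ⟨key h h' hx hM _ _ _ _, key h' h hx.symm (fun i => (hM i).symm) _ _ _ _⟩

theorem Good.snd_eq_of_fun {p p' : Plane} (h : T.Good p) (h' : T.Good p') (hx : p.1 = p'.1)
    {m m' : ℕ → ℕ} (hm : ∀ i, MemGraph p i ↔ OnGraph m i)
    (hm' : ∀ i, MemGraph p' i ↔ OnGraph m' i) (hmm : ∀ k, m k = m' k) : p.2 = p'.2 := by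
  obtain rfl : m = m' := funext hmm
  exact h.snd_eq h' hx fun i => (hm i).trans (hm' i).symm

variable (T)

theorem countable_section (x : ℕ → Bool) : {y : ℕ → Bool | T.Good (x, y)}.Countable := by
  rcases eq_empty_or_nonempty {y : ℕ → Bool | T.Good (x, y)} with he | ⟨y₀, h₀⟩
  · simp [he]
  obtain ⟨m₀, hm₀⟩ := Good.exists_fun h₀
  refine MapsTo.countable_of_injOn (f := fun y => {i | MemGraph (x, y) i})
    (t := range fun q : ℕ × ℕ => {i | OnGraph (Function.update m₀ q.1 q.2) i}) ?_ ?_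
    (countable_range _)
  · intro y hy
    obtain ⟨m, hm⟩ := Good.exists_fun hy
    have hset : {i | MemGraph (x, y) i} = {i | OnGraph m i} := ext hm
    obtain ⟨k, hk⟩ : ∃ k, ∀ k', k' ≠ k → m k' = m₀ k' := by
      by_cases h : ∃ k, m k ≠ m₀ k
      · obtain ⟨k, hk⟩ := h
        refine ⟨k, fun k' hne => ?_⟩
        by_contra hk'
        exact hne (Good.eq_of_ne hy h₀ rfl hm hm₀ hk' hk)
      · push Not at h
        exact ⟨0, fun k' _ => h k'⟩
    refine ⟨(k, m k), ?_⟩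
    simp only [hset]
    congr! 3
    funext k'
    by_cases h : k' = k
    · simp [h]
    · simp [h, hk k' h]
  · intro y hy y' hy' h
    exact Good.snd_eq hy hy' rfl fun i => Set.ext_iff.1 h i

theorem exists_isOpen_inter_section {x y : ℕ → Bool} (hy : T.Good (x, y)) :
    ∃ U : Set (ℕ → Bool), IsOpen U ∧ y ∈ U ∧ U ∩ {v : ℕ → Bool | T.Good (x, v)} = {y} := by
  obtain ⟨m, hm⟩ := Good.exists_fun hy
  have key : ∃ k, ∀ y', T.Good (x, y') → MemGraph (x, y') (Nat.pair k (m k)) → y' = y := by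
    by_cases h : ∃ y₁, T.Good (x, y₁) ∧ y₁ ≠ y
    · obtain ⟨y₁, hy₁, hne⟩ := h
      obtain ⟨m₁, hm₁⟩ := Good.exists_fun hy₁
      obtain ⟨k₁, hk₁⟩ : ∃ k, m₁ k ≠ m k := by
        by_contra! hcon
        exact hne (Good.snd_eq_of_fun hy₁ hy rfl hm₁ hm hcon)
      refine ⟨k₁, fun y' hy' hk => ?_⟩
      by_contra hne'
      obtain ⟨m', hm'⟩ := Good.exists_fun hy'
      obtain ⟨k', hk'⟩ : ∃ k, m' k ≠ m k := by
        by_contra! hcon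
        exact hne' (Good.snd_eq_of_fun hy' hy rfl hm' hm hcon)
      have h1 : m' k₁ = m k₁ := by simpa [hm', OnGraph] using hk
      have h2 : k' ≠ k₁ := by
        rintro rfl
        exact hk' h1
      have h3 : m₁ k' = m k' := by
        by_contra h3
        exact h2 (Good.eq_of_ne hy₁ hy rfl hm₁ hm h3 hk₁)
      exact h2 (Good.eq_of_ne hy' hy₁ rfl hm' hm₁ (h3 ▸ hk') (h1 ▸ hk₁.symm))
    · push Not at h
      exact ⟨0, fun y' hy' _ => h y' hy'⟩
  obtain ⟨k, hk⟩ := key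
  have hyk : MemGraph (x, y) (Nat.pair k (m k)) := by simp [hm, OnGraph]
  refine ⟨{y' | MemGraph (x, y') (Nat.pair k (m k))},
    (isClopen_memGraph _).isOpen.preimage (Continuous.prodMk_right x), hyk, ?_⟩
  ext y'
  constructor
  · rintro ⟨h1, h2⟩
    exact hk y' h2 h1
  · rintro rfl
    exact ⟨hyk, hy⟩

theorem memGraph_F (z : Pt) (i : ℕ) : MemGraph (T.F z) i ↔ OnGraph z.m i := by
  simp [MemGraph, F]

theorem vis_F (z : Pt) (i j : ℕ) : Vis (MemGraph (T.F z)) i j ↔ Vis (OnGraph z.m) i j := by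
  simp only [Vis, memGraph_F]

theorem shows_F (z : Pt) (i j s t : ℕ) :
    Shows (T.F z) i j s t ↔ Vis (OnGraph z.m) i j ∧ z.a i j s = t := by
  simp [Shows, F]

theorem alive_F (z : Pt) (i j s : ℕ) : Alive (T.F z) i j s ↔ T.o (z.a i j s) ≠ 0 := by
  simp [Alive, F]

variable {T}

theorem good_F {z : Pt} (hz : z ∈ T.Z ∅) (hgen : ∀ i j s u, T.o u < T.o (z.a i j s) →
    ∃ s', 0 < s' ∧ par s' = s ∧ T.o u ≤ T.o (z.a i j s')) : T.Good (T.F z) where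
  total k := ⟨z.m k, by simp [memGraph_F, OnGraph]⟩
  unique k v v' := by
    simp only [memGraph_F, OnGraph, Nat.unpair_pair]
    exact fun h h' => h.symm.trans h'
  vis i j s t := by
    rw [shows_F, vis_F]
    exact And.left
  shows i j s := by
    rw [vis_F]
    exact fun h => ⟨_, (T.shows_F z i j s _).2 ⟨h, rfl⟩⟩
  shows_unique i j s t t' := by
    rw [shows_F, shows_F]
    exact fun h h' => h.2.symm.trans h'.2
  alive i j s t ht := by
    rw [shows_F, alive_F]
    rintro ⟨-, rfl⟩
    exact ht
  not_alive i j s t ht := by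
    rw [shows_F, alive_F]
    rintro ⟨-, rfl⟩
    exact absurd ht
  lt i j s t t' hs ht htΩ := by
    rw [shows_F, shows_F]
    rintro ⟨-, rfl⟩ ⟨-, rfl⟩
    rcases (hz i j).2 s hs with h | h | h
    · rwa [h]
    · exact h
    · exact absurd h.2 htΩ.ne
  reach i j s t u hu := by
    rw [shows_F]
    rintro ⟨hv, rfl⟩
    obtain ⟨s', h⟩ := hgen i j s u hu
    exact ⟨s', _, h, (T.shows_F z i j s' _).2 ⟨hv, rfl⟩⟩
  root i j t := by
    rw [shows_F, memGraph_F, memGraph_F]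
    rintro hi hj ⟨hv, rfl⟩
    rw [(hz i j).1, rootTag_of_vis T subsingleton_empty hv, if_pos hi]
  root_lt i j t := by
    rw [shows_F, memGraph_F]
    rintro ⟨hv, rfl⟩ h
    rw [(hz i j).1, rootTag_of_vis T subsingleton_empty hv] at h
    by_contra hi
    rw [if_neg hi] at h
    exact T.lt.ne h

theorem IsTagging.exists_child {r : Ordinal.{u}} {b : ℕ → ℕ} (hb : T.IsTagging r b) (n : ℕ)
    {s v : ℕ} (hv : T.o v < T.o (b s)) :
    ∃ b', T.IsTagging r b' ∧ (∀ p < n, b p = b' p) ∧ b s = b' s ∧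
      ∃ s', 0 < s' ∧ par s' = s ∧ T.o v ≤ T.o (b' s') := by
  obtain ⟨s', hs', hs0, rfl⟩ := SaintRaymond.exists_child (n + s + 1) s
  let b' : ℕ → ℕ := fun p => if p ≤ n + par s' then b p else if p = s' then v else T.code 0
  have h1 : ∀ p ≤ n + par s', b' p = b p := fun p hp => if_pos hp
  have h2 : b' s' = v := (if_neg (by omega)).trans (if_pos rfl)
  refine ⟨b', ⟨(congrArg T.o (h1 0 (by omega))).trans hb.1, fun p hp0 => ?_⟩,
    fun p hpn => (h1 p (by omega)).symm, (h1 _ (by omega)).symm, s', hs0, rfl, by rw [h2]⟩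
  by_cases hp : p ≤ n + par s'
  · rw [h1 p hp, h1 (par p) ((par_lt hp0).le.trans hp)]
    exact hb.2 p hp0
  · by_cases hps : p = s'
    · subst hps
      rw [h2, h1 (par p) (by omega)]
      exact Or.inr (Or.inl hv)
    · left
      simp [b', hp, hps]

theorem mem_Z_update_tree {L : Set ℕ} {z : Pt} (hz : z ∈ T.Z L) {i j : ℕ} {b : ℕ → ℕ}
    (hb : T.IsTagging (T.rootTag L z.m i j) b) :
    Pt.mk z.m (Function.update z.a i (Function.update (z.a i) j b)) ∈ T.Z L := by
  intro i' j'
  simp only [Pt.mk_m, Pt.mk_a]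
  by_cases hi : i' = i
  · subst hi
    by_cases hj : j' = j
    · subst hj
      simpa using hb
    · simpa [hj] using hz i' j'
  · simpa [hi] using hz i' j'

theorem eventually_reach (L : Set ℕ) : ∀ᶠ z : T.Z L in residual (T.Z L),
    ∀ i j s u, T.o u < T.o (z.1.a i j s) →
      ∃ s', 0 < s' ∧ par s' = s ∧ T.o u ≤ T.o (z.1.a i j s') := by
  simp only [eventually_countable_forall]
  intro i j s v
  refine residual_of_dense_open ?_ ?_
  · refine isOpen_iff_forall_mem_open.2 fun z hz => ?_
    by_cases hv : T.o v < T.o (z.1.a i j s)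
    · obtain ⟨s', h⟩ := hz hv
      refine ⟨_, fun z' hz' _ => ?_, isOpen_Nb L (i + j + s' + 1) z.1, Agree.refl _ _⟩
      exact ⟨s', by rwa [← hz'.2 i (by omega) j (by omega) s' (by omega)]⟩
    · refine ⟨_, fun z' hz' h => absurd h ?_, isOpen_Nb L (i + j + s + 1) z.1, Agree.refl _ _⟩
      rwa [← hz'.2 i (by omega) j (by omega) s (by omega)]
  · refine dense_iff_inter_open.2 fun V hV => ?_
    rintro ⟨z, hzV⟩
    by_cases hv : T.o v < T.o (z.1.a i j s)
    · obtain ⟨O, hO, rfl⟩ := isOpen_induced_iff.1 hV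
      obtain ⟨n, hn⟩ := exists_agree_subset hO hzV
      obtain ⟨b, hb, hbn, hbs, hreach⟩ := (z.2 i j).exists_child n hv
      refine ⟨⟨_, mem_Z_update_tree z.2 hb⟩, hn _ ⟨fun _ _ => rfl, ?_⟩, fun _ => ?_⟩
      · intro i' _ j' _ s' hs'
        simp only [Pt.mk_a]
        by_cases hi : i' = i
        · subst hi
          by_cases hj : j' = j
          · subst hj
            simpa using hbn s' hs'
          · simp [hj]
        · simp [hi]
      · simpa using hreach
    · exact ⟨z, hzV, fun h => absurd h hv⟩

end TagSystem

theorem exists_tagSystem {η : Ordinal.{u}} (hη : η.card ≤ Cardinal.aleph0) (hω : ω ≤ η) :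
    ∃ T : TagSystem.{u}, T.η = η := by
  have hcard : (η + 1 + 1).card ≤ Cardinal.aleph0 := by
    simp only [card_add, card_one]
    exact Cardinal.add_le_aleph0.2 ⟨Cardinal.add_le_aleph0.2
      ⟨hη, Cardinal.one_lt_aleph0.le⟩, Cardinal.one_lt_aleph0.le⟩
  have : Countable (Iio (η + 1 + 1)) := by
    rw [← Cardinal.mk_le_aleph0_iff, Cardinal.mk_Iio_ordinal]
    exact Cardinal.lift_le_aleph0.2 hcard
  have : Infinite (Iio (η + 1 + 1)) := by
    refine Infinite.of_injective (fun n : ℕ => ⟨(n : Ordinal.{u}), ?_⟩) fun m n h => ?_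
    · exact (natCast_lt_omega0 n).trans_le (hω.trans (le_self_add.trans le_self_add))
    · exact Nat.cast_injective (Subtype.ext_iff.1 h)
  obtain ⟨e⟩ : Nonempty (ℕ ≃ Iio (η + 1 + 1)) :=
    ⟨(nonempty_denumerable (Iio (η + 1 + 1))).some.eqv.symm⟩
  exact ⟨{
    o := fun t => e t
    Ω := η + 1
    η := η
    inj := Subtype.val_injective.comp e.injective
    le := fun t => Order.lt_add_one_iff.1 (e t).2
    surj := fun β hβ => ⟨e.symm ⟨β, Order.lt_add_one_iff.2 hβ⟩, by simp⟩
    lt := Order.lt_add_one_iff.2 le_rfl }, rfl⟩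

theorem finite_of_isClosed_of_isolated {S C : Set (ℕ → Bool)} (hC : IsClosed C) (hCS : C ⊆ S)
    (h : ∀ y ∈ S, ∃ U : Set (ℕ → Bool), IsOpen U ∧ y ∈ U ∧ U ∩ S = {y}) : C.Finite := by
  choose! U hU hyU hUS using h
  obtain ⟨t, htC, ht⟩ := hC.isCompact.elim_nhds_subcover U
    fun y hy => (hU y (hCS hy)).mem_nhds (hyU y (hCS hy))
  refine t.finite_toSet.subset fun y hy => ?_
  obtain ⟨z, hz, hyz⟩ := mem_iUnion₂.1 (ht hy)
  obtain rfl : y = z := (hUS z (hCS (htC z hz))).subset ⟨hyz, hCS hy⟩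
  exact hz

namespace TagSystem

variable {T : TagSystem.{u}}

theorem rootTag_update (L : Set ℕ) (m : ℕ → ℕ) {l : ℕ} (hl : l ∈ L) (v i j : ℕ) :
    T.rootTag L (Function.update m l v) i j = T.rootTag L m i j := by
  have key : ∀ i, ((Nat.unpair i).1 ∈ L ∨ OnGraph (Function.update m l v) i) ↔
      ((Nat.unpair i).1 ∈ L ∨ OnGraph m i) := by
    intro i
    by_cases h : (Nat.unpair i).1 = l
    · simp [h, hl]
    · simp [OnGraph, h]
  unfold rootTag
  congr 1
  exact propext (and_congr (key i) (key j))

end TagSystem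

/-- Change the function coded by a point at `l`. -/
def Pt.change (l v : ℕ) (z : Pt) : Pt := Function.update z (Sum.inl l) v

@[simp] theorem Pt.change_m (l v : ℕ) (z : Pt) : (z.change l v).m = Function.update z.m l v := by
  funext k
  by_cases h : k = l <;> simp [Pt.change, Pt.m, Function.update, h]

@[simp] theorem Pt.change_a (l v : ℕ) (z : Pt) : (z.change l v).a = z.a := by
  funext i j s
  simp [Pt.change, Pt.a]

theorem Agree.change {n : ℕ} {g z : Pt} (h : Agree n g z) (l v : ℕ) :
    Agree n (g.change l v) (z.change l v) := by
  refine ⟨fun k hk => ?_, by simpa using h.2⟩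
  by_cases hkl : k = l
  · simp [hkl]
  · simpa [hkl] using h.1 k hk

theorem Pt.change_change_self (l v : ℕ) (z : Pt) : (z.change l v).change l (z.m l) = z := by
  simp [Pt.change, Pt.m]

namespace TagSystem

variable {T : TagSystem.{u}}

theorem change_mem_Z {L : Set ℕ} {l : ℕ} (hl : l ∈ L) (v : ℕ) {z : Pt} (hz : z ∈ T.Z L) :
    z.change l v ∈ T.Z L := by
  intro i j
  rw [Pt.change_m, Pt.change_a, rootTag_update L _ hl]
  exact hz i j

/-- Changing the function at a point of `L`, as a map of `T.Z L`. -/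
def changeZ {L : Set ℕ} {l : ℕ} (hl : l ∈ L) (v : ℕ) (z : T.Z L) : T.Z L :=
  ⟨z.1.change l v, change_mem_Z hl v z.2⟩

theorem continuous_changeZ {L : Set ℕ} {l : ℕ} (hl : l ∈ L) (v : ℕ) :
    Continuous (changeZ (T := T) hl v) :=
  (continuous_subtype_val.update _ continuous_const).subtype_mk _

theorem isOpenMap_changeZ {L : Set ℕ} {l : ℕ} (hl : l ∈ L) (v : ℕ) :
    IsOpenMap (changeZ (T := T) hl v) := by
  intro V hV
  obtain ⟨O, hO, rfl⟩ := isOpen_induced_iff.1 hV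
  refine isOpen_iff_forall_mem_open.2 ?_
  rintro _ ⟨z, hz, rfl⟩
  obtain ⟨n, hn⟩ := exists_agree_subset hO hz
  refine ⟨_, fun w hw => ?_, isOpen_Nb L (n + l + 1) (z.1.change l v), Agree.refl _ _⟩
  have hwl : v = w.1.m l := by simpa using hw.1 l (by omega)
  refine ⟨changeZ hl (z.1.m l) w, hn _ ?_, Subtype.ext ?_⟩
  · have := (Agree.change hw l (z.1.m l)).mono (by omega : n ≤ n + l + 1)
    rwa [Pt.change_change_self] at this
  · subst hwl
    exact Pt.change_change_self l _ w.1

theorem fst_F_change (l v : ℕ) (z : Pt) : (T.F (z.change l v)).1 = (T.F z).1 := by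
  simp [F]

theorem snd_F_change_injective (l : ℕ) (z : Pt) :
    Function.Injective fun v => (T.F (z.change l v)).2 := by
  intro v v' h
  have h1 : MemGraph (T.F (z.change l v)) (Nat.pair l v) := by simp [memGraph_F, OnGraph]
  have h2 : MemGraph (T.F (z.change l v')) (Nat.pair l v) := by
    unfold MemGraph at h1 ⊢
    rw [← h1]
    exact (congrFun h _).symm
  rw [memGraph_F] at h2
  simpa [OnGraph] using h2.symm

theorem Z_nonempty (L : Set ℕ) : (T.Z L).Nonempty :=
  ⟨Pt.mk 0 fun i j => T.rootOnly (T.rootTag L 0 i j),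
    fun _ _ => T.isTagging_rootOnly (T.rootTag_le _ _ _ _)⟩

open Classical in
/-- Keep the tag trees of `g` with indices below `n`, and make all others root only, with the root
tags prescribed by `L` and `m`. -/
noncomputable def restrict (T : TagSystem.{u}) (n : ℕ) (L : Set ℕ) (m : ℕ → ℕ) (g : Pt)
    (i j : ℕ) : ℕ → ℕ :=
  if i < n ∧ j < n then g.a i j else T.rootOnly (T.rootTag L m i j)

theorem rootTag_singleton {n i j : ℕ} (m : ℕ → ℕ) (hi : i < n) (hj : j < n) :
    T.rootTag {n} m i j = T.rootTag ∅ m i j := by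
  have key : ∀ i < n, ((Nat.unpair i).1 ∈ ({n} : Set ℕ) ∨ OnGraph m i) ↔
      ((Nat.unpair i).1 ∈ (∅ : Set ℕ) ∨ OnGraph m i) := by
    intro i hi
    have := (Nat.unpair_left_le i).trans_lt hi
    simp [this.ne]
  unfold rootTag
  congr 1
  exact propext (and_congr (key i hi) (key j hj))

theorem restrict_mem_Z {n : ℕ} {L : Set ℕ} {m : ℕ → ℕ} {g : Pt}
    (h : ∀ i < n, ∀ j < n, T.IsTagging (T.rootTag L m i j) (g.a i j)) :
    Pt.mk m (T.restrict n L m g) ∈ T.Z L := by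
  intro i j
  simp only [Pt.mk_m, Pt.mk_a, restrict]
  split_ifs with hij
  · exact h i hij.1 j hij.2
  · exact T.isTagging_rootOnly (T.rootTag_le _ _ _ _)

theorem E_restrict {κ : Ordinal.{u}} (hκ : thr κ ≤ T.η) {L L' : Set ℕ} (hL : L.Subsingleton)
    (hL' : L'.Subsingleton) (n n' : ℕ) (m : ℕ → ℕ) (g : Pt) :
    T.E κ n' (Pt.mk m (T.restrict n L m g)) (Pt.mk m (T.restrict n L' m g)) := by
  refine ⟨fun _ _ => rfl, fun i _ j _ s _ => ?_⟩
  simp only [Pt.mk_m, Pt.mk_a, restrict]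
  split_ifs with hij
  · exact ⟨fun _ => rfl, Or.inl rfl⟩
  · refine ⟨fun hv => by rw [T.rootTag_of_vis hL hv, T.rootTag_of_vis hL' hv], ?_⟩
    by_cases hs : s = 0
    · subst hs
      right
      simp only [rootOnly, if_true, T.o_code (T.rootTag_le _ _ _ _)]
      exact ⟨hκ.trans (T.le_rootTag _ _ _ _), hκ.trans (T.le_rootTag _ _ _ _)⟩
    · simp [rootOnly, hs]

theorem exists_not_isMeagre_of_good {B : ℕ → Set Plane} (hB : {p | T.Good p} ⊆ ⋃ n, B n) :
    ∃ n, ¬ IsMeagre {z : T.Z ∅ | T.F z ∈ B n} := by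
  by_contra! hcon
  obtain ⟨z, hz⟩ := T.Z_nonempty ∅
  have h1 : IsMeagre {z : T.Z ∅ | ¬ T.Good (T.F z)} := by
    filter_upwards [T.eventually_reach ∅] with z hz hz'
    exact hz' (good_F z.2 hz)
  refine not_isMeagre_of_isOpen isOpen_univ ⟨(⟨z, hz⟩ : T.Z ∅), mem_univ _⟩
    ((h1.union (isMeagre_iUnion hcon)).mono fun z _ => ?_)
  by_cases hz : T.Good (T.F z)
  · obtain ⟨n, hn⟩ := mem_iUnion.1 (hB hz)
    exact Or.inr (mem_iUnion.2 ⟨n, hn⟩)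
  · exact Or.inl hz

theorem exists_forall_change_mem {κ : Ordinal.{u}} (hκ : thr κ ≤ T.η) {B : Set Plane}
    (hB : Bᶜ ∈ Sigma0 Plane κ) (hBM : ¬ IsMeagre {z : T.Z ∅ | T.F z ∈ B}) :
    ∃ (l : ℕ) (z : Pt), ∀ v, T.F (z.change l v) ∈ B := by
  have hS : BaireMeasurableSet {z : T.Z ∅ | T.F z ∈ B} :=
    (baireMeasurableSet_preimage_of_mem_Sigma0
      (T.continuous_F.comp continuous_subtype_val) _ _ hB).of_compl
  obtain ⟨z₀, -⟩ := T.Z_nonempty ∅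
  obtain ⟨g, hg, n, -, -, hmeag⟩ := exists_Nb_isMeagre_diff (n := 0) (g := z₀) hS
    fun h => hBM (h.mono (by exact fun z hz => ⟨⟨by simp, by simp⟩, hz⟩))
  have hn : n ∈ ({n} : Set ℕ) := rfl
  let m : ℕ → ℕ → ℕ := fun v => Function.update g.m n v
  have hmg : ∀ v, ∀ k < n, g.m k = m v k := fun v k hk => by simp [m, hk.ne]
  let g' : ℕ → Pt := fun v => Pt.mk (m v) (T.restrict n {n} (m v) g)
  have hg1 : ∀ v, ∀ i < n, ∀ j < n, T.IsTagging (T.rootTag ∅ (m v) i j) (g.a i j) := by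
    intro v i hi j hj
    rw [← T.rootTag_congr ∅ (hmg v) hi hj]
    exact hg i j
  have hg2 : ∀ v, g' v ∈ T.Z {n} := fun v => restrict_mem_Z fun i hi j hj => by
    rw [rootTag_singleton _ hi hj]
    exact hg1 v i hi j hj
  have hg3 : ∀ v, (g' 0).change n v = g' v := by
    intro v
    have : T.restrict n {n} (m v) g = T.restrict n {n} (m 0) g := by
      funext i j
      simp only [restrict, m, rootTag_update {n} _ hn]
    funext c
    rcases c with k | ⟨i, j, s⟩
    · change ((g' 0).change n v).m k = (g' v).m k
      simp [g', m]
    · change ((g' 0).change n v).a i j s = (g' v).a i j s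
      simp [g', this]
  have hmeag' : ∀ v, IsMeagre (Nb {n} (n + 1) (g' v) ∩ {z : T.Z {n} | T.F z ∈ Bᶜ}) := by
    intro v
    by_contra hcon
    refine not_isMeagre_transfer hκ κ le_rfl {n} ∅ subsingleton_singleton subsingleton_empty
      (n + 1) (g' v) (Pt.mk (m v) (T.restrict n ∅ (m v) g)) (restrict_mem_Z (hg1 v))
      (E_restrict hκ subsingleton_singleton subsingleton_empty _ _ _ _) Bᶜ hB hcon
      (hmeag.mono (by
        refine fun z hz =>
          ⟨Agree.trans (g := Pt.mk (m v) _) ⟨hmg v, ?_⟩ (hz.1.mono n.le_succ), hz.2⟩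
        intro i hi j hj s _
        simp [restrict, hi, hj]))
  have hmeag'' : IsMeagre (⋃ v, changeZ (T := T) hn v ⁻¹'
      (Nb {n} (n + 1) (g' v) ∩ {z : T.Z {n} | T.F z ∈ Bᶜ})) :=
    isMeagre_iUnion fun v =>
      (hmeag' v).preimage_of_isOpenMap (continuous_changeZ hn v) (isOpenMap_changeZ hn v)
  by_contra! hcon
  refine not_isMeagre_of_isOpen (isOpen_Nb {n} (n + 1) (g' 0))
    ⟨⟨g' 0, hg2 0⟩, Agree.refl _ _⟩ (hmeag''.mono fun z hz => ?_)
  obtain ⟨v, hv⟩ := hcon n z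
  exact mem_iUnion.2 ⟨v, hg3 v ▸ Agree.change hz n v, hv⟩

theorem not_exists_cover {κ : Ordinal.{u}} (hκ : thr κ ≤ T.η) {B : ℕ → Set Plane}
    (hBG : ∀ n, B n ⊆ {p | T.Good p}) (hB : {p | T.Good p} ⊆ ⋃ n, B n)
    (hBκ : ∀ n, (B n)ᶜ ∈ Sigma0 Plane κ)
    (hcl : ∀ n (x : ℕ → Bool), IsClosed {y : ℕ → Bool | (x, y) ∈ B n}) : False := by
  obtain ⟨n, hn⟩ := exists_not_isMeagre_of_good hB
  obtain ⟨l, z, hz⟩ := exists_forall_change_mem hκ (hBκ n) hn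
  refine infinite_of_injective_forall_mem (T.snd_F_change_injective l z) (fun v => ?_)
    (finite_of_isClosed_of_isolated (hcl n (T.F z).1) (fun y hy => hBG n hy)
      fun y hy => T.exists_isOpen_inter_section hy)
  have := hz v
  rwa [← Prod.mk.eta (p := T.F (z.change l v)), fst_F_change] at this

end TagSystem

end SaintRaymond

end

/-- For every countable ordinal `α ≥ 1` there is a `G_δ` set `G ⊆ 2^ω × 2^ω` with all
sections countable and relatively discrete which cannot be covered by countably many
`Σ⁰_α` sets with closed sections. -/
theorem no_bound_in_Saint_Raymond_Gdelta
    (α : Ordinal) (hα1 : 1 ≤ α) (hα2 : α < (Cardinal.aleph 1).ord) :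
    ∃ G : Set ((ℕ → Bool) × (ℕ → Bool)),
      (∃ U : ℕ → Set ((ℕ → Bool) × (ℕ → Bool)), (∀ n, IsOpen (U n)) ∧ G = ⋂ n, U n) ∧
      (∀ x : ℕ → Bool, {y : ℕ → Bool | (x, y) ∈ G}.Countable) ∧
      (∀ (x : ℕ → Bool) (y : ℕ → Bool), (x, y) ∈ G →
        ∃ U : Set (ℕ → Bool), IsOpen U ∧ y ∈ U ∧ U ∩ {v : ℕ → Bool | (x, v) ∈ G} = {y}) ∧
      ¬ ∃ B : ℕ → Set ((ℕ → Bool) × (ℕ → Bool)),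
          (∀ n : ℕ, B n ⊆ G) ∧ (⋃ n, B n) = G ∧
          (∀ n : ℕ, B n ∈ Sigma0 ((ℕ → Bool) × (ℕ → Bool)) α) ∧
          (∀ (n : ℕ) (x : ℕ → Bool), IsClosed {y : ℕ → Bool | (x, y) ∈ B n}) := by
  have hαc : α.card ≤ Cardinal.aleph0 := Cardinal.lt_aleph_one_iff.1 (Cardinal.lt_ord.1 hα2)
  obtain ⟨T, hT⟩ := SaintRaymond.exists_tagSystem (η := SaintRaymond.thr (α + 1))
    (by
      simp only [SaintRaymond.thr, Ordinal.card_add, Ordinal.card_mul, Ordinal.card_omega0,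
        Ordinal.card_one]
      exact Cardinal.add_le_aleph0.2 ⟨(mul_le_mul' le_rfl (Cardinal.add_le_aleph0.2
        ⟨hαc, Cardinal.one_lt_aleph0.le⟩)).trans Cardinal.aleph0_mul_aleph0.le,
        Cardinal.one_lt_aleph0.le⟩)
    (by
      rw [SaintRaymond.thr, mul_add, mul_one]
      exact le_add_self.trans le_self_add)
  refine ⟨{p | T.Good p}, (isGδ_iff_eq_iInter_nat.1 T.isGδ_good), T.countable_section,
    fun x y => T.exists_isOpen_inter_section, ?_⟩
  rintro ⟨B, hBG, hB, hBα, hcl⟩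
  have hlt : α < α + 1 := Order.lt_add_one_iff.2 le_rfl
  refine T.not_exists_cover hT.ge hBG hB.ge (fun n => ?_) hcl
  rw [Sigma0]
  exact Or.inr ⟨hα1.trans_lt hlt, fun _ => B n, fun _ => α, fun _ => ⟨hα1, hlt, hBα n⟩,
    (Set.iUnion_const _).symm⟩
end
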